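/- arXiv:2104.10146 — 6 statements merged into one kernel-verified Lean document; each statement's English description precedes it below -/
import Mathlib

section
/- Let A be a k×l matrix with entries in R = ℂ[x₁,…,xₙ], let M ⊆ R^k be the submodule spanned by its columns, let u ∈ ℂⁿ, and let A(u) be the complex k×l matrix obtained by evaluating every entry of A at u. Then: (i) for c ∈ ℂ^k, the function z ↦ c·exp(u₁z₁+⋯+uₙzₙ) lies in Sol(M) if and only if the row vector cᵀA(u) is zero; and (ii) u lies in the common zero set of Ann_R(R^k/M) if and only if there exists a nonzero c ∈ ℂ^k with cᵀA(u) = 0. -/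
open MvPolynomial

/-- Partial derivative of a function `ℝⁿ → ℂ` in the `i`-th coordinate direction. -/
noncomputable def pdF {n : ℕ} (i : Fin n) (f : (Fin n → ℝ) → ℂ) : (Fin n → ℝ) → ℂ :=
  fun z => fderiv ℝ f z (Pi.single i 1)

/-- Iterated partial derivative `∂^α f` for a multi-index `α`. -/
noncomputable def ipdF {n : ℕ} (α : Fin n → ℕ) (f : (Fin n → ℝ) → ℂ) : (Fin n → ℝ) → ℂ :=
  ((List.ofFn fun i : Fin n => (pdF i)^[α i]).foldr (· ∘ ·) id) f

/-- The constant-coefficient differential operator `p(∂)` applied to a function: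
`p(∂)•f = ∑_α c_α ∂^α f` where `p = ∑_α c_α x^α`. -/
noncomputable def PDop {n : ℕ} (p : MvPolynomial (Fin n) ℂ) (f : (Fin n → ℝ) → ℂ) :
    (Fin n → ℝ) → ℂ :=
  ∑ α ∈ p.support, (p.coeff α) • ipdF (fun i => α i) f

/-- The solution space `Sol(M)` of a submodule `M ⊆ R^k`: the smooth functions
`ψ : ℝⁿ → ℂ^k` with `∑_j m_j(∂)•ψ_j = 0` for all `m ∈ M`. -/
def SolM {n k : ℕ} (M : Submodule (MvPolynomial (Fin n) ℂ) (Fin k → MvPolynomial (Fin n) ℂ)) :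
    Set (Fin k → (Fin n → ℝ) → ℂ) :=
  {ψ | (∀ j, ContDiff ℝ (⊤ : ℕ∞) (ψ j)) ∧ ∀ m ∈ M, (∑ j, PDop (m j) (ψ j)) = 0}

lemma pdF_smul_exp {n : ℕ} (u : Fin n → ℂ) (i : Fin n) (a : ℂ) :
    pdF i (fun z : Fin n → ℝ => a * Complex.exp (∑ i, u i * (z i : ℂ))) =
      fun z => (a * u i) * Complex.exp (∑ i, u i * (z i : ℂ)) := by
  funext z
  have hcoord (j : Fin n) : HasFDerivAt (fun z : Fin n → ℝ => u j * (z j : ℂ))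
      (u j • (Complex.ofRealCLM ∘L ContinuousLinearMap.proj j)) z :=
    (ContinuousLinearMap.hasFDerivAt (x := z) (Complex.ofRealCLM ∘L
      ContinuousLinearMap.proj (R := ℝ) (φ := fun _ : Fin n => ℝ) j)).const_mul (u j)
  have hexp := ((HasFDerivAt.fun_sum fun j (_ : j ∈ Finset.univ) => hcoord j).cexp).const_mul a
  rw [pdF, hexp.fderiv]
  simp [Pi.single_apply, apply_ite Complex.ofReal]
  ring

lemma iterate_pdF_smul_exp {n : ℕ} (u : Fin n → ℂ) (i : Fin n) (r : ℕ) (a : ℂ) :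
    (pdF i)^[r] (fun z : Fin n → ℝ => a * Complex.exp (∑ i, u i * (z i : ℂ))) =
      fun z => (a * u i ^ r) * Complex.exp (∑ i, u i * (z i : ℂ)) := by
  induction r with
  | zero => simp
  | succ r ih => rw [Function.iterate_succ_apply', ih, pdF_smul_exp, pow_succ, mul_assoc]

lemma ipdF_smul_exp {n : ℕ} (u : Fin n → ℂ) (α : Fin n → ℕ) (a : ℂ) :
    ipdF α (fun z : Fin n → ℝ => a * Complex.exp (∑ i, u i * (z i : ℂ))) =
      fun z => (a * ∏ i, u i ^ α i) * Complex.exp (∑ i, u i * (z i : ℂ)) := by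
  have key (L : List (Fin n)) :
      ((L.map fun i => (pdF i)^[α i]).foldr (· ∘ ·) id)
        (fun z : Fin n → ℝ => a * Complex.exp (∑ i, u i * (z i : ℂ))) =
      fun z => (a * (L.map fun i => u i ^ α i).prod) *
        Complex.exp (∑ i, u i * (z i : ℂ)) := by
    induction L with
    | nil => simp
    | cons i L ih =>
      simp only [List.map_cons, List.foldr_cons, Function.comp_apply, List.prod_cons]
      rw [ih, iterate_pdF_smul_exp]
      funext z
      ring
  rw [ipdF, List.ofFn_eq_map, key, ← List.ofFn_eq_map, List.prod_ofFn]

lemma PDop_smul_exp {n : ℕ} (u : Fin n → ℂ) (p : MvPolynomial (Fin n) ℂ) (a : ℂ) :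
    PDop p (fun z : Fin n → ℝ => a * Complex.exp (∑ i, u i * (z i : ℂ))) =
      fun z => (a * eval u p) * Complex.exp (∑ i, u i * (z i : ℂ)) := by
  funext z
  simp only [PDop, ipdF_smul_exp, Finset.sum_apply, Pi.smul_apply, smul_eq_mul,
    eval_eq', Finset.mul_sum, Finset.sum_mul]
  exact Finset.sum_congr rfl fun α _ => by ring

lemma smul_exp_mem_SolM_iff {n k : ℕ}
    (M : Submodule (MvPolynomial (Fin n) ℂ) (Fin k → MvPolynomial (Fin n) ℂ))
    (u : Fin n → ℂ) (c : Fin k → ℂ) :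
    (fun j => fun z : Fin n → ℝ => c j * Complex.exp (∑ i, u i * (z i : ℂ))) ∈ SolM M ↔
      ∀ m ∈ M, ∑ j, c j * eval u (m j) = 0 := by
  have hsmooth (j : Fin k) : ContDiff ℝ (⊤ : ℕ∞)
      (fun z : Fin n → ℝ => c j * Complex.exp (∑ i, u i * (z i : ℂ))) := by
    refine contDiff_const.mul (ContDiff.cexp (ContDiff.sum fun i _ => contDiff_const.mul ?_))
    exact Complex.ofRealCLM.contDiff.comp (contDiff_apply ℝ ℝ i)
  simp only [SolM, Set.mem_ofPred_eq, PDop_smul_exp]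
  refine ⟨fun h m hm => ?_, fun h => ⟨hsmooth, fun m hm => ?_⟩⟩
  · simpa using congrFun (h.2 m hm) 0
  · funext z
    simp [← Finset.sum_mul, h m hm]

lemma forall_mem_span_range_sum_eval_eq_zero_iff {σ ι κ : Type*} [Fintype κ]
    (v : ι → κ → MvPolynomial σ ℂ) (u : σ → ℂ) (c : κ → ℂ) :
    (∀ m ∈ Submodule.span (MvPolynomial σ ℂ) (Set.range v), ∑ j, c j * eval u (m j) = 0) ↔
      ∀ i, ∑ j, c j * eval u (v i j) = 0 := by
  refine ⟨fun h i => h _ (Submodule.subset_span ⟨i, rfl⟩), fun h m hm => ?_⟩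
  induction hm using Submodule.span_induction with
  | mem x hx => obtain ⟨i, rfl⟩ := hx; exact h i
  | zero => simp
  | add x y _ _ hx hy => simp [mul_add, Finset.sum_add_distrib, hx, hy]
  | smul p x _ hx =>
    simp only [Pi.smul_apply, smul_eq_mul, map_mul, mul_left_comm _ (eval u p)]
    rw [← Finset.mul_sum, hx, mul_zero]

lemma mem_annihilator_quotient_iff {R V : Type*} [CommRing R] [AddCommGroup V] [Module R V]
    (M : Submodule R V) (f : R) : f ∈ Module.annihilator R (V ⧸ M) ↔ ∀ v, f • v ∈ M := by
  rw [Module.mem_annihilator, (Submodule.mkQ_surjective M).forall]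
  simp only [Submodule.mkQ_apply, ← Submodule.Quotient.mk_smul, Submodule.Quotient.mk_eq_zero]

lemma det_mul_mem_annihilator_quotient_span_col {R : Type*} [CommRing R] {κ ι : Type*}
    [Fintype κ] [DecidableEq κ] [Fintype ι] (A : Matrix κ ι R) (B : Matrix ι κ R) :
    (A * B).det ∈ Module.annihilator R ((κ → R) ⧸ Submodule.span R (Set.range A.col)) := by
  rw [mem_annihilator_quotient_iff]
  intro v
  rw [← Matrix.range_mulVecLin]
  refine ⟨B.mulVec ((A * B).adjugate.mulVec v), ?_⟩
  rw [Matrix.mulVecLin_apply, Matrix.mulVec_mulVec, Matrix.mulVec_mulVec, Matrix.mul_adjugate,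
    Matrix.smul_mulVec, Matrix.one_mulVec]

lemma exists_mul_eq_one_of_vecMul_eq_zero_imp {K : Type*} [Field K] {κ ι : Type*}
    [Fintype κ] [DecidableEq κ] [Fintype ι] (A : Matrix κ ι K)
    (h : ∀ c, Matrix.vecMul c A = 0 → c = 0) : ∃ B : Matrix ι κ K, A * B = 1 := by
  obtain ⟨g, hg⟩ := A.vecMulLinear.exists_leftInverse_of_injective
    (LinearMap.ker_eq_bot'.2 h)
  classical
  refine ⟨LinearMap.toMatrixRight' g, Matrix.toLinearMapRight'.injective ?_⟩
  rw [Matrix.toLinearMapRight'_mul, Matrix.toLinearMapRight'_one,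
    show Matrix.toLinearMapRight' (LinearMap.toMatrixRight' g) = g from
      LinearMap.toMatrixRight'.symm_apply_apply g]
  exact hg

/-- for `M` the column span of a `k×l` matrix `A` over `R = ℂ[x₁,…,xₙ]` and
`u ∈ ℂⁿ`: (i) `z ↦ c·exp(uᵀz)` lies in `Sol(M)` iff the row vector `cᵀA(u)` vanishes;
(ii) `u` lies in the zero set of `Ann_R(R^k/M)` iff `cᵀA(u) = 0` for some nonzero `c`. -/
theorem stmt1 {n k l : ℕ}
    (A : Matrix (Fin k) (Fin l) (MvPolynomial (Fin n) ℂ))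
    (M : Submodule (MvPolynomial (Fin n) ℂ) (Fin k → MvPolynomial (Fin n) ℂ))
    (hM : M = Submodule.span (MvPolynomial (Fin n) ℂ)
      (Set.range fun j : Fin l => fun i : Fin k => A i j))
    (u : Fin n → ℂ) :
    (∀ c : Fin k → ℂ,
      ((fun j => fun z : Fin n → ℝ => c j * Complex.exp (∑ i, u i * (z i : ℂ))) ∈ SolM M
        ↔ ∀ i : Fin l, (∑ j, c j * MvPolynomial.eval u (A j i)) = 0)) ∧
    ((∀ f ∈ Module.annihilator (MvPolynomial (Fin n) ℂ)
        ((Fin k → MvPolynomial (Fin n) ℂ) ⧸ M), MvPolynomial.eval u f = 0)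
      ↔ ∃ c : Fin k → ℂ, c ≠ 0 ∧
          ∀ i : Fin l, (∑ j, c j * MvPolynomial.eval u (A j i)) = 0) := by
  have hspan (c : Fin k → ℂ) : (∀ m ∈ M, ∑ j, c j * eval u (m j) = 0) ↔
      ∀ i : Fin l, ∑ j, c j * eval u (A j i) = 0 := by
    rw [hM]
    exact forall_mem_span_range_sum_eval_eq_zero_iff (fun i j => A j i) u c
  refine ⟨fun c => (smul_exp_mem_SolM_iff M u c).trans (hspan c), fun h => ?_, ?_⟩
  · by_contra! hc
    obtain ⟨B, hB⟩ := exists_mul_eq_one_of_vecMul_eq_zero_imp (A.map (eval u)) fun c h0 => by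
      by_contra hne
      obtain ⟨i, hi⟩ := hc c hne
      exact hi (congrFun h0 i)
    obtain ⟨B', hB'⟩ : ∃ B' : Matrix (Fin l) (Fin k) (MvPolynomial (Fin n) ℂ),
        B'.map (eval u) = B := ⟨B.map C, by ext; simp⟩
    have hmem : (A * B').det ∈ Module.annihilator (MvPolynomial (Fin n) ℂ)
        ((Fin k → MvPolynomial (Fin n) ℂ) ⧸ M) := by
      rw [hM]
      exact det_mul_mem_annihilator_quotient_span_col A B'
    have hdet := ((eval u).map_det (A * B')).symm.trans (h _ hmem)
    rw [RingHom.mapMatrix_apply, Matrix.map_mul, hB', hB, Matrix.det_one] at hdet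
    exact one_ne_zero hdet
  · rintro ⟨c, hc, hA⟩ f hf
    obtain ⟨j, hj⟩ := Function.ne_iff.1 hc
    have h := (hspan c).2 hA _ ((mem_annihilator_quotient_iff M f).1 hf (Pi.single j 1))
    have hj' : c j ≠ 0 := hj
    simpa [Pi.single_apply, apply_ite, hj'] using h
end

section
/- Let M ⊆ R^k be a submodule of the free module over R = ℂ[x₁,…,xₙ] and let u ∈ ℂⁿ. There exists a nonzero vector q ∈ ℂ[z₁,…,zₙ]^k of polynomials such that the function z ↦ q(z)·exp(u₁z₁+⋯+uₙzₙ) lies in Sol(M) if and only if u lies in the common zero set of Ann_R(R^k/M). -/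
open MvPolynomial

/-- The polynomial-exponential function `z ↦ p(z) exp(uᵀz)` on `ℝⁿ`. -/
noncomputable def polyExp {n : ℕ} (u : Fin n → ℂ) (p : MvPolynomial (Fin n) ℂ) :
    (Fin n → ℝ) → ℂ :=
  fun z => MvPolynomial.eval (fun i => (z i : ℂ)) p * Complex.exp (∑ i, u i * (z i : ℂ))

theorem contDiff_ofReal_apply {n : ℕ} (i : Fin n) :
    ContDiff ℝ (⊤ : ℕ∞) fun z : Fin n → ℝ => (z i : ℂ) :=
  Complex.ofRealCLM.contDiff.comp (contDiff_apply ℝ ℝ i)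

theorem contDiff_eval_ofReal {n : ℕ} (p : MvPolynomial (Fin n) ℂ) :
    ContDiff ℝ (⊤ : ℕ∞) fun z : Fin n → ℝ => MvPolynomial.eval (fun i => (z i : ℂ)) p := by
  induction p using MvPolynomial.induction_on with
  | C a => simpa using contDiff_const
  | add p q hp hq => simpa using hp.add hq
  | mul_X p i hp => simpa using hp.mul (contDiff_ofReal_apply i)

theorem contDiff_sum_mul_ofReal {n : ℕ} (u : Fin n → ℂ) :
    ContDiff ℝ (⊤ : ℕ∞) fun z : Fin n → ℝ => ∑ i, u i * (z i : ℂ) :=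
  ContDiff.sum fun i _ => contDiff_const.mul (contDiff_ofReal_apply i)

theorem contDiff_polyExp {n : ℕ} (u : Fin n → ℂ) (p : MvPolynomial (Fin n) ℂ) :
    ContDiff ℝ (⊤ : ℕ∞) (polyExp u p) :=
  (contDiff_eval_ofReal p).mul (contDiff_sum_mul_ofReal u).cexp

theorem pdF_ofReal_apply {n : ℕ} (i j : Fin n) :
    pdF i (fun z : Fin n → ℝ => (z j : ℂ)) = fun _ => if i = j then 1 else 0 := by
  funext z
  have h : HasFDerivAt (fun z : Fin n → ℝ => (z j : ℂ))
      (Complex.ofRealCLM.comp (ContinuousLinearMap.proj (R := ℝ) (φ := fun _ : Fin n => ℝ) j)) z :=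
    (Complex.ofRealCLM.comp
      (ContinuousLinearMap.proj (R := ℝ) (φ := fun _ : Fin n => ℝ) j)).hasFDerivAt
  simp [pdF, h.fderiv, Pi.single_apply, eq_comm, apply_ite]

theorem pdF_add {n : ℕ} (i : Fin n) {f g : (Fin n → ℝ) → ℂ} (hf : Differentiable ℝ f)
    (hg : Differentiable ℝ g) : pdF i (fun z => f z + g z) = fun z => pdF i f z + pdF i g z := by
  funext z
  simp [pdF, fderiv_fun_add (hf z) (hg z)]

theorem pdF_mul {n : ℕ} (i : Fin n) {f g : (Fin n → ℝ) → ℂ} (hf : Differentiable ℝ f)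
    (hg : Differentiable ℝ g) :
    pdF i (fun z => f z * g z) = fun z => f z * pdF i g z + pdF i f z * g z := by
  funext z
  simp [pdF, fderiv_fun_mul (hf z) (hg z), mul_comm]

theorem pdF_eval_ofReal {n : ℕ} (i : Fin n) (p : MvPolynomial (Fin n) ℂ) :
    pdF i (fun z : Fin n → ℝ => MvPolynomial.eval (fun i => (z i : ℂ)) p) =
      fun z => MvPolynomial.eval (fun i => (z i : ℂ)) (pderiv i p) := by
  have hd (p : MvPolynomial (Fin n) ℂ) := (contDiff_eval_ofReal p).differentiable (by simp)
  induction p using MvPolynomial.induction_on with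
  | C a => funext z; simp [pdF]
  | add p q hp hq => simp only [map_add, pdF_add i (hd p) (hd q), hp, hq]
  | mul_X p j hp =>
    have hX := (contDiff_ofReal_apply j).differentiable (by simp)
    simp only [map_mul, eval_X, pdF_mul i (hd p) hX, hp, pdF_ofReal_apply, pderiv_mul, map_add,
      pderiv_X]
    funext z
    by_cases h : i = j <;> simp [h, add_comm, eq_comm]

theorem pdF_sum_mul_ofReal {n : ℕ} (u : Fin n → ℂ) (i : Fin n) :
    pdF i (fun z : Fin n → ℝ => ∑ j, u j * (z j : ℂ)) = fun _ => u i := by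
  have h := pdF_eval_ofReal i (∑ j, C (u j) * X j)
  simpa [pderiv_X, Pi.single_apply] using h

theorem pdF_polyExp {n : ℕ} (u : Fin n → ℂ) (i : Fin n) (p : MvPolynomial (Fin n) ℂ) :
    pdF i (polyExp u p) = polyExp u (pderiv i p + C (u i) * p) := by
  have hs := (contDiff_sum_mul_ofReal u).differentiable (by simp)
  unfold polyExp
  rw [pdF_mul i ((contDiff_eval_ofReal p).differentiable (by simp)) hs.cexp, pdF_eval_ofReal]
  funext z
  have h : pdF i (fun z : Fin n → ℝ => Complex.exp (∑ j, u j * (z j : ℂ))) z =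
      Complex.exp (∑ j, u j * (z j : ℂ)) * u i := by
    rw [← congrFun (pdF_sum_mul_ofReal u i) z]
    simp [pdF, ((hs z).hasFDerivAt.cexp).fderiv]
  rw [h]
  simp only [map_add, map_mul, eval_C]
  ring

theorem polyExp_injective {n : ℕ} (u : Fin n → ℂ) : Function.Injective (polyExp u) := by
  intro p q h
  refine MvPolynomial.funext_set (fun _ => Set.range ((↑) : ℝ → ℂ))
    (fun _ => Set.infinite_range_of_injective Complex.ofReal_injective) fun x hx => ?_
  choose z hz using fun i => hx i (Set.mem_univ i)
  obtain rfl : (fun i => (z i : ℂ)) = x := _root_.funext hz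
  exact mul_right_cancel₀ (Complex.exp_ne_zero _) (congrFun h z)

theorem polyExp_zero {n : ℕ} (u : Fin n → ℂ) : polyExp u 0 = 0 := by
  funext z
  simp [polyExp]

theorem polyExp_add {n : ℕ} (u : Fin n → ℂ) (p q : MvPolynomial (Fin n) ℂ) :
    polyExp u (p + q) = polyExp u p + polyExp u q := by
  funext z
  simp [polyExp, add_mul]

theorem polyExp_smul {n : ℕ} (u : Fin n → ℂ) (a : ℂ) (p : MvPolynomial (Fin n) ℂ) :
    polyExp u (a • p) = a • polyExp u p := by
  funext z
  simp [polyExp, mul_assoc]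

/-- The operator `T` acts on the functions `p(z) exp(uᵀz)` with `deg p ≤ d` so that the
homogeneous component of `p` of degree `d` is multiplied by `a`. -/
def ScalesTop {n : ℕ} (u : Fin n → ℂ) (d : ℕ)
    (T : ((Fin n → ℝ) → ℂ) → (Fin n → ℝ) → ℂ) (a : ℂ) : Prop :=
  ∀ p : MvPolynomial (Fin n) ℂ, (∀ β, d < β.degree → coeff β p = 0) →
    ∃ r : MvPolynomial (Fin n) ℂ, (∀ β, d < β.degree → coeff β r = 0) ∧
      T (polyExp u p) = polyExp u r ∧ ∀ β, β.degree = d → coeff β r = a * coeff β p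

namespace ScalesTop

variable {n : ℕ} {u : Fin n → ℂ} {d : ℕ}

theorem id : ScalesTop u d id 1 := fun p hp => ⟨p, hp, rfl, by simp⟩

theorem comp {S T : ((Fin n → ℝ) → ℂ) → (Fin n → ℝ) → ℂ} {a b : ℂ} (hS : ScalesTop u d S a)
    (hT : ScalesTop u d T b) : ScalesTop u d (S ∘ T) (a * b) := by
  intro p hp
  obtain ⟨r, hr, hTr, hrc⟩ := hT p hp
  obtain ⟨s, hs, hSs, hsc⟩ := hS r hr
  exact ⟨s, hs, by simp [hTr, hSs], fun β hβ => by rw [hsc β hβ, hrc β hβ, mul_assoc]⟩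

theorem iterate {T : ((Fin n → ℝ) → ℂ) → (Fin n → ℝ) → ℂ} {a : ℂ} (hT : ScalesTop u d T a)
    (m : ℕ) : ScalesTop u d T^[m] (a ^ m) := by
  induction m with
  | zero => simpa using ScalesTop.id
  | succ m ih => rw [Function.iterate_succ, pow_succ]; exact ih.comp hT

theorem foldr_ofFn {m : ℕ} (T : Fin m → ((Fin n → ℝ) → ℂ) → (Fin n → ℝ) → ℂ) (a : Fin m → ℂ)
    (h : ∀ i, ScalesTop u d (T i) (a i)) :
    ScalesTop u d ((List.ofFn T).foldr (· ∘ ·) _root_.id) (∏ i, a i) := by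
  induction m with
  | zero => simpa using ScalesTop.id
  | succ m ih =>
    rw [List.ofFn_succ, List.foldr_cons, Fin.prod_univ_succ]
    exact (h 0).comp (ih _ _ fun i => h i.succ)

theorem pdF (i : Fin n) : ScalesTop u d (pdF i) (u i) := by
  intro p hp
  have hc (β : Fin n →₀ ℕ) (hβ : d ≤ β.degree) : coeff β (pderiv i p) = 0 := by
    rw [coeff_pderiv, hp _ (by rw [map_add, Finsupp.degree_single]; omega), zero_mul]
  refine ⟨_, fun β hβ => ?_, pdF_polyExp u i p, fun β hβ => ?_⟩
  · rw [coeff_add, coeff_C_mul, hc β hβ.le, hp β hβ, mul_zero, add_zero]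
  · rw [coeff_add, coeff_C_mul, hc β hβ.ge, zero_add]

theorem ipdF (α : Fin n → ℕ) : ScalesTop u d (ipdF α) (∏ i, u i ^ α i) :=
  foldr_ofFn _ _ fun i => (pdF i).iterate (α i)

theorem zero : ScalesTop u d 0 0 := fun _ _ => ⟨0, by simp, by simp [polyExp_zero], by simp⟩

theorem add {S T : ((Fin n → ℝ) → ℂ) → (Fin n → ℝ) → ℂ} {a b : ℂ} (hS : ScalesTop u d S a)
    (hT : ScalesTop u d T b) : ScalesTop u d (S + T) (a + b) := by
  intro p hp
  obtain ⟨r, hr, hSr, hrc⟩ := hS p hp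
  obtain ⟨s, hs, hTs, hsc⟩ := hT p hp
  refine ⟨r + s, fun β hβ => by simp [hr β hβ, hs β hβ], ?_, fun β hβ => ?_⟩
  · rw [Pi.add_apply, hSr, hTs, polyExp_add]
  · rw [coeff_add, hrc β hβ, hsc β hβ, add_mul]

theorem smul {T : ((Fin n → ℝ) → ℂ) → (Fin n → ℝ) → ℂ} {a : ℂ} (c : ℂ) (hT : ScalesTop u d T a) :
    ScalesTop u d (c • T) (c * a) := by
  intro p hp
  obtain ⟨r, hr, hTr, hrc⟩ := hT p hp
  refine ⟨c • r, fun β hβ => by simp [hr β hβ], ?_, fun β hβ => ?_⟩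
  · rw [Pi.smul_apply, hTr, polyExp_smul]
  · rw [coeff_smul, hrc β hβ, smul_eq_mul, mul_assoc]

theorem sum {ι : Type*} (s : Finset ι) (T : ι → ((Fin n → ℝ) → ℂ) → (Fin n → ℝ) → ℂ) (a : ι → ℂ)
    (h : ∀ i, ScalesTop u d (T i) (a i)) : ScalesTop u d (∑ i ∈ s, T i) (∑ i ∈ s, a i) := by
  classical
  induction s using Finset.induction_on with
  | empty => simpa using zero
  | insert i s hi ih => rw [Finset.sum_insert hi, Finset.sum_insert hi]; exact (h i).add ih

theorem PDop (f : MvPolynomial (Fin n) ℂ) : ScalesTop u d (PDop f) (eval u f) := by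
  have hT : _root_.PDop f = ∑ α ∈ f.support, coeff α f • _root_.ipdF fun i => α i := by
    funext g
    simp [_root_.PDop]
  rw [hT, eval_eq']
  exact sum _ _ _ fun α => (ipdF fun i => α i).smul (coeff α f)

end ScalesTop

theorem PDop_zero {n : ℕ} (f : (Fin n → ℝ) → ℂ) : PDop 0 f = 0 := by
  simp [PDop]

theorem PDop_polyExp_C {n : ℕ} (u : Fin n → ℂ) (f : MvPolynomial (Fin n) ℂ) (c : ℂ) :
    PDop f (polyExp u (C c)) = polyExp u (C (eval u f * c)) := by
  have hC (b : ℂ) (β : Fin n →₀ ℕ) (hβ : 0 < β.degree) : coeff β (C b) = 0 := by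
    rw [coeff_C, if_neg]
    rintro rfl
    simp at hβ
  obtain ⟨r, hr, hPr, hrc⟩ := ScalesTop.PDop (u := u) (d := 0) f (C c) (hC c)
  rw [hPr]
  congr 1
  ext β
  rcases Nat.eq_zero_or_pos β.degree with hβ | hβ
  · rw [hrc β hβ, (Finsupp.degree_eq_zero_iff β).1 hβ, coeff_zero_C, coeff_zero_C]
  · rw [hr β hβ, hC _ β hβ]

theorem eval_eq_zero_of_PDop_polyExp_eq_zero {n : ℕ} {u : Fin n → ℂ}
    {f q : MvPolynomial (Fin n) ℂ} (hq : q ≠ 0) (h : PDop f (polyExp u q) = 0) :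
    eval u f = 0 := by
  obtain ⟨β, hβ, hmax⟩ := q.support.exists_max_image Finsupp.degree (support_nonempty.2 hq)
  obtain ⟨r, -, hPr, hrc⟩ := ScalesTop.PDop (u := u) (d := β.degree) f q fun γ hγ => by
    by_contra hne
    exact (hmax γ (mem_support_iff.2 hne)).not_gt hγ
  obtain rfl : r = 0 := polyExp_injective u (by rw [← hPr, h, polyExp_zero])
  have := hrc β rfl
  rw [coeff_zero, eq_comm, mul_eq_zero] at this
  exact this.resolve_right (mem_support_iff.1 hβ)

/-- If the fibre of `R^k / M` at `u` vanishes, then so does its localisation at `u`. -/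
theorem exists_mem_annihilator_eval_ne_zero {n k : ℕ}
    (M : Submodule (MvPolynomial (Fin n) ℂ) (Fin k → MvPolynomial (Fin n) ℂ)) (u : Fin n → ℂ)
    (h : ∀ v : Fin k → ℂ, ∃ m ∈ M, (fun j => eval u (m j)) = v) :
    ∃ f ∈ Module.annihilator (MvPolynomial (Fin n) ℂ)
      ((Fin k → MvPolynomial (Fin n) ℂ) ⧸ M), eval u f ≠ 0 := by
  let I : Ideal (MvPolynomial (Fin n) ℂ) := RingHom.ker (eval u)
  have hle : (⊤ : Submodule (MvPolynomial (Fin n) ℂ) ((Fin k → MvPolynomial (Fin n) ℂ) ⧸ M)) ≤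
      I • ⊤ := by
    rintro x -
    obtain ⟨p, rfl⟩ := M.mkQ_surjective x
    obtain ⟨m, hm, hmp⟩ := h fun j => eval u (p j)
    have hx : M.mkQ p = M.mkQ (p - m) := by
      rw [map_sub, (M.mkQ_apply m).trans ((Submodule.Quotient.mk_eq_zero M).2 hm), sub_zero]
    rw [hx, ← Finset.univ_sum_single (p - m), map_sum]
    refine Submodule.sum_mem _ fun j _ => ?_
    have hj : Pi.single j ((p - m) j) = (p - m) j • Pi.single j (1 : MvPolynomial (Fin n) ℂ) := by
      rw [← Pi.single_smul, smul_eq_mul, mul_one]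
    rw [hj, map_smul]
    refine Submodule.smul_mem_smul ?_ trivial
    rw [RingHom.mem_ker, Pi.sub_apply, map_sub, sub_eq_zero]
    exact (congrFun hmp j).symm
  obtain ⟨f, hf, hf0⟩ := Submodule.exists_sub_one_mem_and_smul_eq_zero_of_fg_of_le_smul I ⊤
    Module.Finite.fg_top hle
  refine ⟨f, Module.mem_annihilator.2 fun x => hf0 x trivial, ?_⟩
  rw [RingHom.mem_ker, map_sub, map_one, sub_eq_zero] at hf
  simp [hf]

/-- there is a nonzero polynomial vector `q` with
`z ↦ q(z)·exp(uᵀz) ∈ Sol(M)` iff `u` lies in the zero set of `Ann_R(R^k/M)`. -/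
theorem stmt2 {n k : ℕ}
    (M : Submodule (MvPolynomial (Fin n) ℂ) (Fin k → MvPolynomial (Fin n) ℂ))
    (u : Fin n → ℂ) :
    (∃ q : Fin k → MvPolynomial (Fin n) ℂ, q ≠ 0 ∧
      (fun j => fun z : Fin n → ℝ =>
        MvPolynomial.eval (fun i => (z i : ℂ)) (q j) * Complex.exp (∑ i, u i * (z i : ℂ)))
        ∈ SolM M)
    ↔ ∀ f ∈ Module.annihilator (MvPolynomial (Fin n) ℂ)
        ((Fin k → MvPolynomial (Fin n) ℂ) ⧸ M), MvPolynomial.eval u f = 0 := by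
  constructor
  · rintro ⟨q, hq, -, hsol⟩ f hf
    obtain ⟨j, hj⟩ := Function.ne_iff.1 hq
    refine eval_eq_zero_of_PDop_polyExp_eq_zero hj ?_
    have hmem : Pi.single j f ∈ M := by
      have := Module.mem_annihilator.1 hf (Submodule.Quotient.mk (Pi.single j 1))
      rwa [← Submodule.Quotient.mk_smul, Submodule.Quotient.mk_eq_zero, ← Pi.single_smul,
        smul_eq_mul, mul_one] at this
    have hsum := hsol _ hmem
    rw [Finset.sum_eq_single_of_mem j (Finset.mem_univ j)
      fun i _ hij => by rw [Pi.single_eq_of_ne hij, PDop_zero], Pi.single_eq_same] at hsum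
    exact hsum
  · intro hu
    let L : (Fin k → MvPolynomial (Fin n) ℂ) →ₗ[ℂ] (Fin k → ℂ) :=
      LinearMap.pi fun j => (aeval u).toLinearMap ∘ₗ LinearMap.proj j
    have hL (m) (j) : L m j = eval u (m j) := by simp [L]
    have hlt : (M.restrictScalars ℂ).map L < ⊤ := by
      refine lt_top_iff_ne_top.2 fun htop => ?_
      obtain ⟨f, hf, hf0⟩ := exists_mem_annihilator_eval_ne_zero M u fun v => by
        obtain ⟨m, hm, hmv⟩ : v ∈ (M.restrictScalars ℂ).map L := htop ▸ trivial
        exact ⟨m, hm, by rw [← hmv]; exact _root_.funext fun j => (hL m j).symm⟩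
      exact hf0 (hu f hf)
    obtain ⟨φ, hφ, hφM⟩ := Submodule.exists_le_ker_of_lt_top _ hlt
    have hφ_apply (v : Fin k → ℂ) : φ v = ∑ j, v j * φ (Pi.single j 1) := by
      conv_lhs => rw [pi_eq_sum_univ' v]
      simp
    refine ⟨fun j => C (φ (Pi.single j 1)), fun h => hφ ?_, fun j => contDiff_polyExp u _,
      fun m hm => ?_⟩
    · ext j
      simpa using congrFun h j
    · have hsum : ∑ j, eval u (m j) * φ (Pi.single j 1) = 0 := by
        have := hφM (Submodule.mem_map_of_mem (f := L) hm)
        rw [LinearMap.mem_ker, hφ_apply] at this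
        simpa only [hL] using this
      calc ∑ j, PDop (m j) (polyExp u (C (φ (Pi.single j 1))))
          = ∑ j, polyExp u (C (eval u (m j) * φ (Pi.single j 1))) :=
            Finset.sum_congr rfl fun j _ => PDop_polyExp_C u _ _
        _ = 0 := by
          funext z
          simp only [polyExp, Finset.sum_apply, eval_C, ← Finset.sum_mul, hsum, zero_mul,
            Pi.zero_apply]
end

section
/- Let K be an algebraically closed field, R = K[x₁,…,xₙ], and M ⊆ R^k a submodule. The quotient R^k/M is finite-dimensional as a K-vector space if and only if the common zero set in Kⁿ of the ideal Ann_R(R^k/M) is a finite set. -/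
open MvPolynomial

/-- The common zero set in `Kⁿ` of an ideal of the polynomial ring `K[x₁,…,xₙ]`. -/
def zeroSet {K : Type} [CommSemiring K] {n : ℕ}
    (I : Ideal (MvPolynomial (Fin n) K)) : Set (Fin n → K) :=
  {u | ∀ f ∈ I, MvPolynomial.eval u f = 0}

theorem zeroSet_eq_zeroLocus {K : Type} [Field K] {n : ℕ}
    (I : Ideal (MvPolynomial (Fin n) K)) : zeroSet I = zeroLocus K I := by
  ext u
  simp [zeroSet, mem_zeroLocus_iff, aeval_eq_eval]

/-- If an `R`-module is finite-dimensional over `K`, the annihilator contains a nonzero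
polynomial in each variable, so its zero set is finite. -/
theorem zeroSet_annihilator_finite {K : Type} [Field K] {n : ℕ} (Q : Type*) [AddCommGroup Q]
    [Module K Q] [Module (MvPolynomial (Fin n) K) Q]
    [IsScalarTower K (MvPolynomial (Fin n) K) Q] [FiniteDimensional K Q] :
    (zeroSet (Module.annihilator (MvPolynomial (Fin n) K) Q)).Finite := by
  let φ : MvPolynomial (Fin n) K →ₐ[K] Module.End K Q := Algebra.lsmul K K Q
  let p : Fin n → Polynomial K := fun i ↦ minpoly K (φ (X i))
  have hp (i) : p i ≠ 0 := minpoly.ne_zero (Algebra.IsIntegral.isIntegral (φ (X i)))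
  have hmem (i) : Polynomial.aeval (X i : MvPolynomial (Fin n) K) (p i) ∈
      Module.annihilator (MvPolynomial (Fin n) K) Q := by
    rw [Module.mem_annihilator]
    intro q
    have h : φ (Polynomial.aeval (X i) (p i)) = 0 := by
      rw [← Polynomial.aeval_algHom_apply]
      exact minpoly.aeval K _
    exact LinearMap.congr_fun h q
  refine (Set.Finite.pi' fun i ↦ (p i).rootSet_finite K).subset fun u hu i ↦ ?_
  rw [Polynomial.mem_rootSet]
  refine ⟨hp i, ?_⟩
  have h := hu _ (hmem i)
  rwa [← aeval_eq_eval, ← Polynomial.aeval_algHom_apply, aeval_X] at h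

/-- If the zero set of `I` is finite, the Nullstellensatz makes every element of `R ⧸ I`
integral over `K`. -/
theorem finite_quotient_of_zeroSet_finite {K : Type} [Field K] [IsAlgClosed K] {n : ℕ}
    (I : Ideal (MvPolynomial (Fin n) K)) (hI : (zeroSet I).Finite) :
    Module.Finite K (MvPolynomial (Fin n) K ⧸ I) := by
  have : Algebra.IsIntegral K (MvPolynomial (Fin n) K ⧸ I) := by
    refine ⟨fun x ↦ ?_⟩
    obtain ⟨f, rfl⟩ := Ideal.Quotient.mkₐ_surjective K I x
    let q : Polynomial K := ∏ u ∈ hI.toFinset, (Polynomial.X - Polynomial.C (eval u f))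
    have hq : q.Monic := Polynomial.monic_prod_of_monic _ _ fun u _ ↦ Polynomial.monic_X_sub_C _
    have hrad : Polynomial.aeval f q ∈ I.radical := by
      rw [← vanishingIdeal_zeroLocus_eq_radical (K := K), mem_vanishingIdeal_iff]
      intro u hu
      rw [← zeroSet_eq_zeroLocus] at hu
      rw [← Polynomial.aeval_algHom_apply, map_prod]
      refine Finset.prod_eq_zero (hI.mem_toFinset.2 hu) ?_
      simp [aeval_eq_eval]
    obtain ⟨N, hN⟩ := hrad
    refine ⟨q ^ N, hq.pow N, ?_⟩
    rw [← Polynomial.aeval_def, Polynomial.aeval_algHom_apply, map_pow]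
    exact Ideal.Quotient.eq_zero_iff_mem.2 hN
  exact Algebra.IsIntegral.finite

/-- over an algebraically closed field `K`, the quotient `R^k/M` is
finite-dimensional over `K` iff the zero set of `Ann_R(R^k/M)` in `Kⁿ` is finite. -/
theorem stmt3 {K : Type} [Field K] [IsAlgClosed K] {n k : ℕ}
    (M : Submodule (MvPolynomial (Fin n) K) (Fin k → MvPolynomial (Fin n) K)) :
    FiniteDimensional K ((Fin k → MvPolynomial (Fin n) K) ⧸ M) ↔
    (zeroSet (Module.annihilator (MvPolynomial (Fin n) K)
      ((Fin k → MvPolynomial (Fin n) K) ⧸ M))).Finite := by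
  refine ⟨fun _ ↦ zeroSet_annihilator_finite _, fun h ↦ ?_⟩
  let Q := (Fin k → MvPolynomial (Fin n) K) ⧸ M
  let A := MvPolynomial (Fin n) K ⧸ Module.annihilator (MvPolynomial (Fin n) K) Q
  have : Module.Finite K A := finite_quotient_of_zeroSet_finite _ h
  have hQ := Module.isTorsionBySet_annihilator (MvPolynomial (Fin n) K) Q
  let : Module A Q := hQ.module
  have : IsScalarTower (MvPolynomial (Fin n) K) A Q := hQ.isScalarTower
  have : IsScalarTower K A Q := hQ.isScalarTower
  have : Module.Finite A Q := .of_restrictScalars_finite (MvPolynomial (Fin n) K) A Q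
  exact Module.Finite.trans A Q
end

section
/- Let K be a field of characteristic zero, R = K[x₁,…,xₙ], and M ⊊ R^k a proper submodule such that the only associated prime of R^k/M is the maximal ideal m = ⟨x₁,…,xₙ⟩. Then the K-vector space of polynomial solutions of M, namely {q ∈ R^k : ∑_{j=1}^k m_j(∂)•q_j = 0 for all m ∈ M}, is finite-dimensional of dimension equal to dim_K(R^k/M). -/
open MvPolynomial

/-- Iterated formal partial derivative `∂^α q` of a polynomial `q`. -/
noncomputable def ipdP {K : Type} [CommSemiring K] {n : ℕ} (α : Fin n → ℕ)
    (q : MvPolynomial (Fin n) K) : MvPolynomial (Fin n) K :=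
  ((List.ofFn fun i : Fin n => (fun g => (MvPolynomial.pderiv i) g)^[α i]).foldr (· ∘ ·) id) q

/-- The operator `p(∂)` acting formally on a polynomial `q`:
`p(∂)•q = ∑_α c_α ∂^α q` where `p = ∑_α c_α x^α`. -/
noncomputable def PDopP {K : Type} [CommSemiring K] {n : ℕ}
    (p q : MvPolynomial (Fin n) K) : MvPolynomial (Fin n) K :=
  ∑ α ∈ p.support, (p.coeff α) • ipdP (fun i => α i) q

open scoped Nat

namespace MvPolynomial

variable {K : Type} [Field K] {n : ℕ}

/-- The linear functional `q ↦ α! q_α`, i.e. the constant coefficient of `∂^α q`. -/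
noncomputable def factorialCoeff (K : Type) [Field K] {n : ℕ} (α : Fin n →₀ ℕ) :
    MvPolynomial (Fin n) K →ₗ[K] K :=
  (∏ i, ((α i)! : K)) • lcoeff K α

theorem factorialCoeff_apply (α : Fin n →₀ ℕ) (q : MvPolynomial (Fin n) K) :
    factorialCoeff K α q = (∏ i, ((α i)! : K)) * coeff α q := rfl

theorem prod_factorial_ne_zero [CharZero K] (α : Fin n →₀ ℕ) :
    ∏ i, ((α i)! : K) ≠ 0 :=
  Finset.prod_ne_zero_iff.mpr fun i _ => by exact_mod_cast (α i).factorial_ne_zero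

theorem eq_zero_of_factorialCoeff [CharZero K] {q : MvPolynomial (Fin n) K}
    (h : ∀ α, factorialCoeff K α q = 0) : q = 0 := by
  ext α
  simpa [factorialCoeff_apply, prod_factorial_ne_zero] using h α

theorem factorialCoeff_pderiv (β : Fin n →₀ ℕ) (i : Fin n) (q : MvPolynomial (Fin n) K) :
    factorialCoeff K β (pderiv i q) = factorialCoeff K (β + Finsupp.single i 1) q := by
  have h : ∏ j, (((β + Finsupp.single i 1 : Fin n →₀ ℕ) j)! : K) = (β i + 1) * ∏ j, ((β j)! : K) := by
    rw [← Finset.mul_prod_erase _ _ (Finset.mem_univ i),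
      ← Finset.mul_prod_erase _ (fun j => ((β j)! : K)) (Finset.mem_univ i), ← mul_assoc]
    congr 1
    · simp [Nat.factorial_succ]
    · refine Finset.prod_congr rfl fun j hj => ?_
      simp [Finsupp.single_eq_of_ne (Finset.ne_of_mem_erase hj)]
  rw [factorialCoeff_apply, factorialCoeff_apply, coeff_pderiv, h]
  ring

theorem factorialCoeff_iterate_pderiv (i : Fin n) (a : ℕ) (β : Fin n →₀ ℕ)
    (q : MvPolynomial (Fin n) K) :
    factorialCoeff K β ((fun g => pderiv i g)^[a] q) =
      factorialCoeff K (β + Finsupp.single i a) q := by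
  induction a generalizing β with
  | zero => simp
  | succ a ih =>
    rw [Function.iterate_succ_apply', factorialCoeff_pderiv, ih, add_assoc,
      ← Finsupp.single_add, add_comm 1 a]

theorem factorialCoeff_foldr_pderiv (α : Fin n → ℕ) (l : List (Fin n)) (β : Fin n →₀ ℕ)
    (q : MvPolynomial (Fin n) K) :
    factorialCoeff K β
        ((l.map fun i => (fun g => (pderiv (R := K) i) g)^[α i]).foldr (· ∘ ·) id q) =
      factorialCoeff K (β + (l.map fun i => Finsupp.single i (α i)).sum) q := by
  induction l generalizing β with
  | nil => simp
  | cons i l ih =>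
    rw [List.map_cons, List.foldr_cons, Function.comp_apply, factorialCoeff_iterate_pderiv, ih,
      List.map_cons, List.sum_cons, add_assoc]

theorem factorialCoeff_ipdP (α β : Fin n →₀ ℕ) (q : MvPolynomial (Fin n) K) :
    factorialCoeff K β (ipdP (fun i => α i) q) = factorialCoeff K (β + α) q := by
  rw [ipdP, List.ofFn_eq_map, factorialCoeff_foldr_pderiv, ← List.ofFn_eq_map, List.sum_ofFn,
    Finsupp.univ_sum_single]

/-- The apolar pairing `(p, q) ↦ ∑_α α! p_α q_α`, i.e. the constant coefficient of `p(∂)•q`. -/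
noncomputable def apolarPairing (K : Type) [Field K] (n : ℕ) :
    MvPolynomial (Fin n) K →ₗ[K] Module.Dual K (MvPolynomial (Fin n) K) :=
  (basisMonomials (Fin n) K).constr K (factorialCoeff K)

theorem apolarPairing_monomial (α : Fin n →₀ ℕ) (a : K) (q : MvPolynomial (Fin n) K) :
    apolarPairing K n (monomial α a) q = a * factorialCoeff K α q := by
  have h : apolarPairing K n (monomial α 1) = factorialCoeff K α := by
    exact (basisMonomials (Fin n) K).constr_basis K _ α
  rw [← mul_one a, ← smul_eq_mul, ← smul_monomial, map_smul, h, LinearMap.smul_apply,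
    smul_eq_mul, smul_eq_mul, mul_one]

theorem factorialCoeff_PDopP (β : Fin n →₀ ℕ) (p q : MvPolynomial (Fin n) K) :
    factorialCoeff K β (PDopP p q) = apolarPairing K n (monomial β 1 * p) q := by
  conv_rhs => rw [p.as_sum, Finset.mul_sum, map_sum, LinearMap.sum_apply]
  rw [PDopP, map_sum]
  refine Finset.sum_congr rfl fun α _ => ?_
  rw [map_smul, factorialCoeff_ipdP, monomial_mul, one_mul, apolarPairing_monomial, smul_eq_mul]

/-- The apolar pairing on vectors of polynomials, sending `q` to `p ↦ ∑_j ⟨p_j, q_j⟩`. -/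
noncomputable def vectorApolarPairing (K : Type) [Field K] (n k : ℕ) :
    (Fin k → MvPolynomial (Fin n) K) →ₗ[K] Module.Dual K (Fin k → MvPolynomial (Fin n) K) :=
  (LinearMap.lsum K (fun _ : Fin k => MvPolynomial (Fin n) K) K).toLinearMap ∘ₗ
    (apolarPairing K n).flip.compLeft (Fin k)

variable {k : ℕ}

theorem vectorApolarPairing_apply (q p : Fin k → MvPolynomial (Fin n) K) :
    vectorApolarPairing K n k q p = ∑ j, apolarPairing K n (p j) (q j) := by
  simp [vectorApolarPairing]

theorem vectorApolarPairing_single (q : Fin k → MvPolynomial (Fin n) K) (j : Fin k)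
    (α : Fin n →₀ ℕ) :
    vectorApolarPairing K n k q (Pi.single j (monomial α 1)) = factorialCoeff K α (q j) := by
  rw [vectorApolarPairing_apply, Finset.sum_eq_single j]
  · rw [Pi.single_eq_same, apolarPairing_monomial, one_mul]
  · intro i _ hij
    rw [Pi.single_eq_of_ne hij, map_zero, LinearMap.zero_apply]
  · simp

theorem vectorApolarPairing_injective [CharZero K] :
    Function.Injective (vectorApolarPairing K n k) := by
  refine (injective_iff_map_eq_zero _).mpr fun q hq => ?_
  refine _root_.funext fun j => eq_zero_of_factorialCoeff fun α => ?_
  rw [← vectorApolarPairing_single, hq, LinearMap.zero_apply]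

theorem dual_ext {f g : Module.Dual K (Fin k → MvPolynomial (Fin n) K)}
    (h : ∀ j α, f (Pi.single j (monomial α 1)) = g (Pi.single j (monomial α 1))) : f = g := by
  refine LinearMap.pi_ext' fun j => (basisMonomials (Fin n) K).ext fun α => ?_
  simpa using h j α

/-- A functional vanishing on all but finitely many monomials in each component is represented by
a vector of polynomials. -/
theorem mem_range_vectorApolarPairing [CharZero K]
    {f : Module.Dual K (Fin k → MvPolynomial (Fin n) K)} {s : Set (Fin n →₀ ℕ)} (hs : s.Finite)
    (hf : ∀ j, ∀ α ∉ s, f (Pi.single j (monomial α 1)) = 0) :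
    f ∈ LinearMap.range (vectorApolarPairing K n k) := by
  classical
  refine ⟨fun j => ∑ α ∈ hs.toFinset,
    monomial α ((∏ i, ((α i)! : K))⁻¹ * f (Pi.single j (monomial α 1))), dual_ext fun j α => ?_⟩
  rw [vectorApolarPairing_single, factorialCoeff_apply, coeff_sum]
  simp only [coeff_monomial, Finset.sum_ite_eq', Set.Finite.mem_toFinset]
  split_ifs with h
  · rw [mul_inv_cancel_left₀ (prod_factorial_ne_zero α)]
  · rw [mul_zero, hf j α h]

theorem forall_sum_PDopP_eq_zero_iff [CharZero K]
    (M : Submodule (MvPolynomial (Fin n) K) (Fin k → MvPolynomial (Fin n) K))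
    (q : Fin k → MvPolynomial (Fin n) K) :
    (∀ m ∈ M, ∑ j, PDopP (m j) (q j) = 0) ↔
      vectorApolarPairing K n k q ∈ (M.restrictScalars K).dualAnnihilator := by
  have key (β : Fin n →₀ ℕ) (m : Fin k → MvPolynomial (Fin n) K) :
      factorialCoeff K β (∑ j, PDopP (m j) (q j)) =
        vectorApolarPairing K n k q ((monomial β 1 : MvPolynomial (Fin n) K) • m) := by
    simp_rw [map_sum, factorialCoeff_PDopP, vectorApolarPairing_apply, Pi.smul_apply, smul_eq_mul]
  rw [Submodule.mem_dualAnnihilator]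
  refine ⟨fun h m hm => ?_, fun h m hm => eq_zero_of_factorialCoeff fun β => ?_⟩
  · have := key 0 m
    rw [h m hm, map_zero] at this
    simpa using this.symm
  · rw [key]
    exact h _ (M.smul_mem _ hm)

theorem finite_setOf_degree_lt (N : ℕ) : {α : Fin n →₀ ℕ | α.degree < N}.Finite :=
  (Finsupp.finite_of_degree_le N).subset fun _ (h : _ < N) => h.le

theorem finite_quotient_of_monomial_mem {s : Set (Fin n →₀ ℕ)} (hs : s.Finite)
    {M : Submodule K (Fin k → MvPolynomial (Fin n) K)}
    (hM : ∀ j : Fin k, ∀ α ∉ s, Pi.single j (monomial α (1 : K)) ∈ M) :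
    Module.Finite K ((Fin k → MvPolynomial (Fin n) K) ⧸ M) := by
  let b := Pi.basis fun _ : Fin k => basisMonomials (Fin n) K
  refine Module.finite_def.mpr (Submodule.fg_def.mpr ⟨Set.range (M.mkQ ∘ b), ?_, ?_⟩)
  · refine Set.Finite.subset (((Set.finite_univ.prod hs).image
      fun x : Fin k × (Fin n →₀ ℕ) => M.mkQ (Pi.single x.1 (monomial x.2 1))).insert 0) ?_
    rintro _ ⟨⟨j, α⟩, rfl⟩
    have hb : (M.mkQ ∘ b) ⟨j, α⟩ = M.mkQ (Pi.single j (monomial α 1)) := by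
      simp [b, Pi.basis_apply]
    rw [hb]
    by_cases hα : α ∈ s
    · exact Or.inr ⟨(j, α), ⟨trivial, hα⟩, rfl⟩
    · exact Or.inl ((Submodule.Quotient.mk_eq_zero M).mpr (hM j α hα))
  · rw [Set.range_comp, Submodule.span_image, b.span_eq, Submodule.map_top, Submodule.range_mkQ]

end MvPolynomial

/-- Over a Noetherian ring, if `I` is the only associated prime of a finite module, then a power
of `I` annihilates the module. -/
theorem exists_pow_le_annihilator_of_associatedPrimes_eq_singleton {R N : Type*} [CommRing R]
    [IsNoetherianRing R] [AddCommGroup N] [Module R N] [Module.Finite R N] {I : Ideal R}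
    (h : associatedPrimes R N = {I}) : ∃ d : ℕ, I ^ d ≤ Module.annihilator R N := by
  refine Ideal.exists_pow_le_of_le_radical_of_fg ?_ (IsNoetherian.noetherian I)
  rw [← Ideal.sInf_minimalPrimes]
  refine le_sInf fun J hJ => ?_
  have hJI := h ▸ Module.associatedPrimes.minimalPrimes_annihilator_subset_associatedPrimes R N hJ
  exact (Set.mem_singleton_iff.mp hJI).ge

/-- if `M ⊊ R^k` is proper and the only associated prime of `R^k/M` is
`⟨x₁,…,xₙ⟩`, then the `K`-vector space of polynomial solutions of `M` is
finite-dimensional of dimension `dim_K(R^k/M)`. -/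
theorem stmt5 {K : Type} [Field K] [CharZero K] {n k : ℕ}
    (M : Submodule (MvPolynomial (Fin n) K) (Fin k → MvPolynomial (Fin n) K))
    (hM : M ≠ ⊤)
    (hass : associatedPrimes (MvPolynomial (Fin n) K)
        ((Fin k → MvPolynomial (Fin n) K) ⧸ M)
      = {Ideal.span (Set.range (X : Fin n → MvPolynomial (Fin n) K))}) :
    ∃ V : Submodule K (Fin k → MvPolynomial (Fin n) K),
      (V : Set (Fin k → MvPolynomial (Fin n) K))
        = {q | ∀ m ∈ M, (∑ j, PDopP (m j) (q j)) = 0} ∧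
      FiniteDimensional K V ∧
      Module.finrank K V
        = Module.finrank K ((Fin k → MvPolynomial (Fin n) K) ⧸ M) := by
  obtain ⟨d, hd⟩ := exists_pow_le_annihilator_of_associatedPrimes_eq_singleton hass
  have hs := finite_setOf_degree_lt (n := n) d
  have hmem (j : Fin k) (α : Fin n →₀ ℕ) (hα : α ∉ {α : Fin n →₀ ℕ | α.degree < d}) :
      Pi.single j (monomial α (1 : K)) ∈ M.restrictScalars K := by
    have hpow : (monomial α 1 : MvPolynomial (Fin n) K) ∈ idealOfVars (Fin n) K ^ d :=
      (monomial_mem_pow_idealOfVars_iff d α one_ne_zero).mpr (not_lt.mp hα)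
    have := Module.mem_annihilator.mp (hd hpow) (M.mkQ (Pi.single j 1))
    rw [← map_smul, Submodule.mkQ_apply, Submodule.Quotient.mk_eq_zero, ← Pi.single_smul,
      smul_eq_mul, mul_one] at this
    exact this
  have hfin := finite_quotient_of_monomial_mem hs hmem
  let A := (M.restrictScalars K).dualAnnihilator
  have hA : A ≤ LinearMap.range (vectorApolarPairing K n k) := fun f hf =>
    mem_range_vectorApolarPairing hs fun j α hα =>
      (Submodule.mem_dualAnnihilator f).mp hf _ (hmem j α hα)
  let e₁ := Submodule.equivMapOfInjective (vectorApolarPairing K n k)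
    vectorApolarPairing_injective (A.comap (vectorApolarPairing K n k))
  rw [Submodule.map_comap_eq_of_le hA] at e₁
  let e := e₁ ≪≫ₗ (M.restrictScalars K).dualQuotEquivDualAnnihilator.symm
  refine ⟨A.comap (vectorApolarPairing K n k), ?_, Module.Finite.equiv e.symm, ?_⟩
  · ext q
    exact (forall_sum_PDopP_eq_zero_iff M q).symm
  · rw [e.finrank_eq, Subspace.dual_finrank_eq]
    exact (Submodule.Quotient.restrictScalarsEquiv K M).finrank_eq
end

section
/- Let B ∈ ℂ[x₁,…,xₙ,z₁,…,zₙ]^k be a vector of polynomials in 2n variables, and write each coordinate as B_i = ∑_α c_{i,α}(x)·z^α with c_{i,α} ∈ ℂ[x₁,…,xₙ]. Let A denote the corresponding operator acting on smooth scalar functions g of (x,z) ∈ ℝⁿ×ℝⁿ by (A•g)_i := ∑_α c_{i,α}(x)·(∂_x^α g). Then for every polynomial q ∈ ℂ[x₁,…,xₙ], one has the identity of ℂ^k-valued smooth functions on ℝⁿ×ℝⁿ: q(∂_z)•( B(x,z)·exp(x₁z₁+⋯+xₙzₙ) ) = A•( q(x)·exp(x₁z₁+⋯+xₙzₙ) ),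 where q(∂_z) is applied componentwise on the left. -/
open MvPolynomial

/-- Partial differentiation raises one exponent in a sum of separable functions. -/
theorem pdF_sum_prod_iteratedDeriv {n : ℕ} {ι : Type*} (S : Finset ι) (c : ι → ℂ)
    (g : ι → Fin n → ℝ → ℂ) (hg : ∀ s j, ContDiff ℝ (⊤ : ℕ∞) (g s j))
    (e : Fin n → ℕ) (i : Fin n) :
    pdF i (fun w => ∑ s ∈ S, c s * ∏ j, iteratedDeriv (e j) (g s j) (w j))
      = fun w => ∑ s ∈ S, c s *
          ∏ j, iteratedDeriv ((e + Pi.single i 1 : Fin n → ℕ) j) (g s j) (w j) := by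
  funext w
  have hfactor (s : ι) (j : Fin n) :
      HasFDerivAt (fun w : Fin n → ℝ => iteratedDeriv (e j) (g s j) (w j))
        ((ContinuousLinearMap.toSpanSingleton ℝ (iteratedDeriv (e j + 1) (g s j) (w j))).comp
          (ContinuousLinearMap.proj (R := ℝ) (φ := fun _ : Fin n => ℝ) j)) w := by
    have hdiff : DifferentiableAt ℝ (iteratedDeriv (e j) (g s j)) (w j) :=
      ((hg s j).differentiable_iteratedDeriv (e j) (by exact_mod_cast WithTop.coe_lt_top _)) _
    have hderiv := hdiff.hasDerivAt.hasFDerivAt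
    rw [← iteratedDeriv_succ] at hderiv
    exact hderiv.comp w (hasFDerivAt_apply (𝕜 := ℝ) j w)
  have hsum := HasFDerivAt.fun_sum (u := S) fun s _ =>
    (HasFDerivAt.finsetProd (u := Finset.univ) fun j _ => hfactor s j).const_mul (c s)
  rw [pdF, hsum.fderiv]
  simp only [sum_apply, smul_apply,
    ContinuousLinearMap.comp_apply, ContinuousLinearMap.proj_apply,
    ContinuousLinearMap.toSpanSingleton_apply, smul_eq_mul]
  refine Finset.sum_congr rfl fun s _ => ?_
  congr 1
  rw [Finset.sum_eq_single i (fun j _ hj => by simp [Pi.single_eq_of_ne hj]) (by simp),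
    ← Finset.prod_erase_mul _ _ (Finset.mem_univ i)]
  congr 1
  · refine Finset.prod_congr rfl fun j hj => ?_
    simp [Pi.single_eq_of_ne (Finset.ne_of_mem_erase hj)]
  · simp

/-- Iterated partial derivatives of a sum of separable functions. -/
theorem ipdF_sum_prod {n : ℕ} {ι : Type*} (S : Finset ι) (c : ι → ℂ)
    (g : ι → Fin n → ℝ → ℂ) (hg : ∀ s j, ContDiff ℝ (⊤ : ℕ∞) (g s j)) (α : Fin n → ℕ) :
    ipdF α (fun w => ∑ s ∈ S, c s * ∏ j, g s j (w j))
      = fun w => ∑ s ∈ S, c s * ∏ j, iteratedDeriv (α j) (g s j) (w j) := by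
  have hiter (i : Fin n) (m : ℕ) (e : Fin n → ℕ) :
      (pdF i)^[m] (fun w => ∑ s ∈ S, c s * ∏ j, iteratedDeriv (e j) (g s j) (w j))
        = fun w => ∑ s ∈ S, c s *
            ∏ j, iteratedDeriv ((Pi.single i m + e : Fin n → ℕ) j) (g s j) (w j) := by
    induction m with
    | zero => simp
    | succ m ih =>
      rw [Function.iterate_succ_apply', ih, pdF_sum_prod_iteratedDeriv S c g hg,
        Pi.single_add, add_right_comm]
  have hfold (L : List (Fin n)) :
      ((L.map fun i => (pdF i)^[α i]).foldr (· ∘ ·) id)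
          (fun w => ∑ s ∈ S, c s * ∏ j, g s j (w j))
        = fun w => ∑ s ∈ S, c s *
            ∏ j, iteratedDeriv ((L.map fun i => Pi.single i (α i)).sum j) (g s j) (w j) := by
    induction L with
    | nil => simp
    | cons i L ih =>
      rw [List.map_cons, List.foldr_cons, Function.comp_apply, ih, hiter, List.map_cons,
        List.sum_cons]
  have hα : ((List.finRange n).map fun i => Pi.single i (α i)).sum = α := by
    rw [← List.ofFn_eq_map, List.sum_ofFn, Finset.univ_sum_single]
  have := hfold (List.finRange n)
  rwa [hα, ← List.ofFn_eq_map] at this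

theorem iteratedDeriv_ofReal_pow (a k : ℕ) (t : ℝ) :
    iteratedDeriv k (fun w : ℝ => (w : ℂ) ^ a) t = (a.descFactorial k : ℂ) * (t : ℂ) ^ (a - k) := by
  induction k generalizing t with
  | zero => simp
  | succ k ih =>
    rw [iteratedDeriv_succ, funext ih]
    have hderiv := ((Complex.ofRealCLM.hasDerivAt (x := t)).fun_pow (a - k)).const_mul
      (a.descFactorial k : ℂ)
    simp only [Complex.ofRealCLM_apply] at hderiv
    rw [hderiv.deriv, Nat.descFactorial_succ, Nat.sub_sub]
    push_cast
    ring

theorem iteratedDeriv_cexp_const_mul_ofReal (c : ℂ) (k : ℕ) (t : ℝ) :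
    iteratedDeriv k (fun w : ℝ => Complex.exp (c * (w : ℂ))) t
      = c ^ k * Complex.exp (c * (t : ℂ)) := by
  induction k generalizing t with
  | zero => simp
  | succ k ih =>
    rw [iteratedDeriv_succ, funext ih]
    have hderiv := ((Complex.ofRealCLM.hasDerivAt (x := t)).const_mul c).cexp.const_mul (c ^ k)
    simp only [Complex.ofRealCLM_apply] at hderiv
    rw [hderiv.deriv]
    push_cast
    ring

theorem contDiff_ofReal_pow_mul_cexp (a : ℕ) (c : ℂ) :
    ContDiff ℝ (⊤ : ℕ∞) (fun w : ℝ => (w : ℂ) ^ a * Complex.exp (c * (w : ℂ))) :=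
  (Complex.ofRealCLM.contDiff.pow a).mul
    (contDiff_const.mul Complex.ofRealCLM.contDiff).cexp

/-- The derivatives of `w ^ a * exp (x * w)`, in a form symmetric under exchanging
`(a, t)` with `(b, x)`. -/
theorem iteratedDeriv_ofReal_pow_mul_cexp (a b : ℕ) (x t : ℝ) :
    iteratedDeriv b (fun w : ℝ => (w : ℂ) ^ a * Complex.exp ((x : ℂ) * (w : ℂ))) t
      = ∑ k ∈ Finset.range (a + b + 1), (k.factorial * a.choose k * b.choose k : ℂ) *
          (t : ℂ) ^ (a - k) * (x : ℂ) ^ (b - k) * Complex.exp ((x : ℂ) * (t : ℂ)) := by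
  have hpow : ContDiff ℝ b (fun w : ℝ => (w : ℂ) ^ a) := Complex.ofRealCLM.contDiff.pow a
  have hexp : ContDiff ℝ b (fun w : ℝ => Complex.exp ((x : ℂ) * (w : ℂ))) :=
    (contDiff_const.mul Complex.ofRealCLM.contDiff).cexp
  rw [iteratedDeriv_fun_mul hpow.contDiffAt hexp.contDiffAt]
  refine Finset.sum_subset_zero_on_sdiff (Finset.range_mono (by omega)) (fun k hk => ?_)
    fun k _ => ?_
  · have hbk : b < k := by simp at hk; omega
    simp [Nat.choose_eq_zero_of_lt hbk]
  · rw [iteratedDeriv_ofReal_pow, iteratedDeriv_cexp_const_mul_ofReal,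
      Nat.descFactorial_eq_factorial_mul_choose]
    push_cast
    ring

theorem iteratedDeriv_ofReal_pow_mul_cexp_symm (a b : ℕ) (x t : ℝ) :
    iteratedDeriv b (fun w : ℝ => (w : ℂ) ^ a * Complex.exp ((x : ℂ) * (w : ℂ))) t
      = iteratedDeriv a (fun w : ℝ => (w : ℂ) ^ b * Complex.exp ((t : ℂ) * (w : ℂ))) x := by
  rw [iteratedDeriv_ofReal_pow_mul_cexp, iteratedDeriv_ofReal_pow_mul_cexp, add_comm b a,
    mul_comm (t : ℂ) (x : ℂ)]
  exact Finset.sum_congr rfl fun k _ => by ring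

/-- Iterated partial derivatives of a polynomial times an exponential of a linear form. -/
theorem ipdF_sum_monomial_mul_cexp {n : ℕ} (S : Finset (Fin n →₀ ℕ)) (c : (Fin n →₀ ℕ) → ℂ)
    (x z : Fin n → ℝ) (β : Fin n → ℕ) :
    ipdF β (fun w => (∑ α ∈ S, c α * ∏ j, (w j : ℂ) ^ α j)
        * Complex.exp (∑ j, (x j : ℂ) * (w j : ℂ))) z
      = ∑ α ∈ S, c α * ∏ j, iteratedDeriv (β j)
          (fun t : ℝ => (t : ℂ) ^ α j * Complex.exp ((x j : ℂ) * (t : ℂ))) (z j) := by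
  rw [← congrFun (ipdF_sum_prod S c _
    (fun α j => contDiff_ofReal_pow_mul_cexp (α j) (x j)) β) z]
  simp only [Complex.exp_sum, Finset.sum_mul, Finset.prod_mul_distrib, mul_assoc]

/-- for a vector `B` of polynomials in `(x,z)` (encoded as polynomials in
the `z`-variables with coefficients `c_{i,α}(x) ∈ ℂ[x]`), and any `q ∈ ℂ[x]`, one has
`q(∂_z)•(B(x,z)·exp(xᵀz)) = A•(q(x)·exp(xᵀz))`, where
`(A•g)_i = ∑_α c_{i,α}(x)·∂_x^α g`. -/
theorem stmt10 {n k : ℕ}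
    (B : Fin k → MvPolynomial (Fin n) (MvPolynomial (Fin n) ℂ))
    (q : MvPolynomial (Fin n) ℂ)
    (x z : Fin n → ℝ) (i : Fin k) :
    PDop q (fun w =>
        MvPolynomial.eval₂ (MvPolynomial.eval fun j => (x j : ℂ))
          (fun j => (w j : ℂ)) (B i)
        * Complex.exp (∑ j, (x j : ℂ) * (w j : ℂ))) z
    = ∑ α ∈ (B i).support,
        MvPolynomial.eval (fun j => (x j : ℂ)) ((B i).coeff α) *
          ipdF (fun j => α j)
            (fun v => MvPolynomial.eval (fun j => (v j : ℂ)) q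
              * Complex.exp (∑ j, (v j : ℂ) * (z j : ℂ))) x := by
  have hB (w : Fin n → ℝ) := eval₂_eq' (eval fun j => (x j : ℂ)) (fun j => (w j : ℂ)) (B i)
  have hq (v : Fin n → ℝ) := eval_eq' (fun j => (v j : ℂ)) q
  simp only [PDop, Finset.sum_apply, Pi.smul_apply, smul_eq_mul, hB, hq, mul_comm _ (z _ : ℂ)]
  simp only [ipdF_sum_monomial_mul_cexp, Finset.mul_sum]
  rw [Finset.sum_comm]
  refine Finset.sum_congr rfl fun α _ => Finset.sum_congr rfl fun β _ => ?_
  rw [mul_left_comm, Finset.prod_congr rfl fun j _ =>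
    iteratedDeriv_ofReal_pow_mul_cexp_symm (α j) (β j) (x j) (z j)]
end

section
/- Let n ≥ 1, R = ℂ[x₁,…,xₙ], and let I ⊆ R be the ideal generated by the n power sums p_s = x₁^s + x₂^s + ⋯ + xₙ^s for s = 1,…,n. Then the space of polynomial solutions { q ∈ ℂ[z₁,…,zₙ] : f(∂)•q = 0 for all f ∈ I } is a ℂ-vector space of dimension n!, and it equals the ℂ-linear span of the Vandermonde polynomial Δ = ∏_{1 ≤ i < j ≤ n} (z_i − z_j) together with all of its iterated partial derivatives. -/
open MvPolynomial

section ConstantCoefficientOperators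

variable {K : Type} {n : ℕ}

theorem coeff_iterate_pderiv [CommSemiring K] (i : Fin n) (k : ℕ) (β : Fin n →₀ ℕ)
    (q : MvPolynomial (Fin n) K) :
    coeff β ((fun g => pderiv i g)^[k] q) =
      ((β i + 1).ascFactorial k : K) * coeff (β + Finsupp.single i k) q := by
  induction k generalizing β with
  | zero => simp
  | succ k ih =>
    rw [Function.iterate_succ_apply', coeff_pderiv, ih, add_assoc, ← Finsupp.single_add,
      add_comm 1 k]
    have := Nat.ascFactorial_mul_ascFactorial (β i + 1) 1 k
    rw [add_comm k 1, ← this]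
    simp only [Nat.ascFactorial_succ, Nat.ascFactorial_zero, Finsupp.add_apply,
      Finsupp.single_eq_same]
    push_cast
    ring

theorem coeff_foldr_iterate_pderiv [CommSemiring K] (α : Fin n → ℕ) (l : List (Fin n))
    (hl : l.Nodup) (β : Fin n →₀ ℕ) (q : MvPolynomial (Fin n) K) :
    coeff β (((l.map fun i => (fun g => pderiv i g)^[α i]).foldr (· ∘ ·) id) q) =
      (l.map fun i => ((β i + 1).ascFactorial (α i) : K)).prod *
        coeff (β + (l.map fun i => Finsupp.single i (α i)).sum) q := by
  induction l generalizing β with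
  | nil => simp
  | cons i l ih =>
    obtain ⟨hi, hl⟩ := List.nodup_cons.mp hl
    have hmap : (l.map fun j => (((β + Finsupp.single i (α i)) j + 1).ascFactorial (α j) : K)) =
        l.map fun j => ((β j + 1).ascFactorial (α j) : K) := by
      refine List.map_congr_left fun j hj => ?_
      have hij : i ≠ j := fun h => hi (h ▸ hj)
      simp [Finsupp.single_eq_of_ne' hij]
    simp only [List.map_cons, List.foldr_cons, Function.comp_apply, List.prod_cons, List.sum_cons]
    rw [coeff_iterate_pderiv, ih hl, hmap, add_assoc, mul_assoc]

/-- The coefficient of `∂^α q` at `β` is `(α + β)! / β!` times that of `q` at `β + α`. -/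
theorem coeff_ipdP [CommSemiring K] (α β : Fin n →₀ ℕ) (q : MvPolynomial (Fin n) K) :
    coeff β (ipdP α q) =
      (∏ i, ((β i + 1).ascFactorial (α i) : K)) * coeff (β + α) q := by
  rw [ipdP, List.ofFn_eq_map, coeff_foldr_iterate_pderiv α _ (List.nodup_finRange n),
    ← List.ofFn_eq_map, ← List.ofFn_eq_map, List.prod_ofFn, List.sum_ofFn,
    Finsupp.univ_sum_single]

/-- `α ↦ ∂^α` as a monoid homomorphism into the linear endomorphisms. -/
noncomputable def ipdPHom [CommSemiring K] :
    Multiplicative (Fin n →₀ ℕ) →* Module.End K (MvPolynomial (Fin n) K) where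
  toFun α :=
    { toFun := ipdP ⇑(Multiplicative.toAdd α)
      map_add' := fun p q => by ext β; simp [coeff_ipdP, mul_add]
      map_smul' := fun c q => by ext β; simp [coeff_ipdP, mul_left_comm] }
  map_one' := by
    refine LinearMap.ext fun q => MvPolynomial.ext _ _ fun β => ?_
    exact (coeff_ipdP 0 β q).trans (by simp)
  map_mul' α β := by
    refine LinearMap.ext fun q => MvPolynomial.ext _ _ fun γ => ?_
    simp only [toAdd_mul, LinearMap.coe_mk, AddHom.coe_mk, Module.End.mul_apply, coeff_ipdP]
    rw [← mul_assoc, ← Finset.prod_mul_distrib, add_assoc]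
    congr 1
    refine Finset.prod_congr rfl fun i _ => ?_
    rw [← Nat.cast_mul, Finsupp.add_apply, Finsupp.add_apply,
      ← Nat.ascFactorial_mul_ascFactorial, add_right_comm]

/-- The algebra homomorphism `f ↦ f(∂)`. -/
noncomputable def PDopHom [CommSemiring K] :
    MvPolynomial (Fin n) K →ₐ[K] Module.End K (MvPolynomial (Fin n) K) :=
  AddMonoidAlgebra.lift K _ _ ipdPHom

theorem PDopHom_apply [CommSemiring K] (f q : MvPolynomial (Fin n) K) :
    PDopHom f q = PDopP f q := by
  rw [PDopHom, AddMonoidAlgebra.lift_apply, Finsupp.sum, LinearMap.sum_apply]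
  rfl

theorem PDopHom_monomial [CommSemiring K] (α : Fin n →₀ ℕ) (c : K)
    (q : MvPolynomial (Fin n) K) : PDopHom (monomial α c) q = c • ipdP α q := by
  have : PDopHom (monomial α c) = c • ipdPHom (Multiplicative.ofAdd α) :=
    AddMonoidAlgebra.lift_single _ _ _
  rw [this]
  rfl

theorem PDopHom_comm [CommSemiring K] (f g q : MvPolynomial (Fin n) K) :
    PDopHom f (PDopHom g q) = PDopHom g (PDopHom f q) := by
  rw [← Module.End.mul_apply, ← map_mul, mul_comm, map_mul, Module.End.mul_apply]

/-- The polynomials `q` with `f(∂) q = 0` for all `f ∈ I`. -/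
noncomputable def polySolutions [CommSemiring K] (I : Ideal (MvPolynomial (Fin n) K)) :
    Submodule K (MvPolynomial (Fin n) K) :=
  ⨅ f ∈ I, LinearMap.ker (PDopHom f)

theorem mem_polySolutions [CommSemiring K] {I : Ideal (MvPolynomial (Fin n) K)}
    {q : MvPolynomial (Fin n) K} : q ∈ polySolutions I ↔ ∀ f ∈ I, PDopHom f q = 0 := by
  simp [polySolutions, Submodule.mem_iInf]

theorem mem_polySolutions_span [CommSemiring K] {S : Set (MvPolynomial (Fin n) K)}
    {q : MvPolynomial (Fin n) K} :
    q ∈ polySolutions (Ideal.span S) ↔ ∀ f ∈ S, PDopHom f q = 0 := by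
  refine mem_polySolutions.trans ⟨fun h f hf => h f (Ideal.subset_span hf), fun h f hf => ?_⟩
  induction hf using Submodule.span_induction with
  | mem f hf => exact h f hf
  | zero => simp
  | add f g _ _ hf hg => rw [map_add, LinearMap.add_apply, hf, hg, add_zero]
  | smul a f _ hf => rw [smul_eq_mul, map_mul, Module.End.mul_apply, hf, map_zero]

theorem PDopHom_mem_polySolutions [CommSemiring K] {I : Ideal (MvPolynomial (Fin n) K)}
    {q : MvPolynomial (Fin n) K} (hq : q ∈ polySolutions I) (g : MvPolynomial (Fin n) K) :
    PDopHom g q ∈ polySolutions I :=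
  mem_polySolutions.mpr fun f hf => by
    rw [PDopHom_comm, mem_polySolutions.mp hq f hf, map_zero]

variable [Field K]

/-- The apolarity pairing `(q, f) ↦ (f(∂) q)(0)`, as a map from the solutions of `I` to the dual
of the quotient by `I`. -/
noncomputable def solutionsToDual (I : Ideal (MvPolynomial (Fin n) K)) :
    polySolutions I →ₗ[K] Module.Dual K (MvPolynomial (Fin n) K ⧸ I.restrictScalars K) :=
  LinearMap.flip <| (I.restrictScalars K).liftQ
    (LinearMap.compr₂ ((LinearMap.lcomp K _ (polySolutions I).subtype).comp
      (PDopHom : MvPolynomial (Fin n) K →ₐ[K] _).toLinearMap) (lcoeff K 0)) fun f hf => by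
    ext q
    simp [mem_polySolutions.mp q.2 f hf]

theorem solutionsToDual_mk (I : Ideal (MvPolynomial (Fin n) K)) (q : polySolutions I)
    (f : MvPolynomial (Fin n) K) :
    solutionsToDual I q (Submodule.Quotient.mk f) = coeff 0 (PDopHom f q.1) := rfl

theorem solutionsToDual_injective [CharZero K] (I : Ideal (MvPolynomial (Fin n) K)) :
    Function.Injective (solutionsToDual I) := by
  refine (injective_iff_map_eq_zero _).mpr fun q hq => ?_
  ext α
  have h := solutionsToDual_mk I q (monomial α 1)
  rw [hq, LinearMap.zero_apply, PDopHom_monomial, one_smul, coeff_ipdP, zero_add] at h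
  refine (mul_eq_zero.mp h.symm).resolve_left (Finset.prod_ne_zero_iff.mpr fun i _ => ?_)
  exact Nat.cast_ne_zero.mpr (Nat.ascFactorial_pos _ _).ne'

theorem finite_polySolutions [CharZero K] (I : Ideal (MvPolynomial (Fin n) K))
    [Module.Finite K (MvPolynomial (Fin n) K ⧸ I)] : Module.Finite K (polySolutions I) :=
  have : Module.Finite K (MvPolynomial (Fin n) K ⧸ I.restrictScalars K) :=
    inferInstanceAs (Module.Finite K (MvPolynomial (Fin n) K ⧸ I))
  Module.Finite.of_injective _ (solutionsToDual_injective I)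

theorem finrank_polySolutions_le [CharZero K] (I : Ideal (MvPolynomial (Fin n) K))
    [Module.Finite K (MvPolynomial (Fin n) K ⧸ I)] :
    Module.finrank K (polySolutions I) ≤ Module.finrank K (MvPolynomial (Fin n) K ⧸ I) := by
  have : Module.Finite K (MvPolynomial (Fin n) K ⧸ I.restrictScalars K) :=
    inferInstanceAs (Module.Finite K (MvPolynomial (Fin n) K ⧸ I))
  exact (LinearMap.finrank_le_finrank_of_injective (solutionsToDual_injective I)).trans_eq
    Subspace.dual_finrank_eq

end ConstantCoefficientOperators

section CoinvariantAlgebra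

open scoped Polynomial in
/-- If the elements `x i` are the roots of a monic polynomial with coefficients in the image of a
finite algebra `A`, they generate a subalgebra of dimension at most `m! * dim A`. -/
theorem exists_subalgebra_finrank_le {K B : Type*} [Field K] [CommRing B] [Algebra K B] (m : ℕ)
    {A : Type*} [CommRing A] [Algebra K A] [Module.Finite K A] (φ : A →ₐ[K] B) (g : A[X])
    (hg : g.Monic) (hdeg : g.natDegree = m) (x : Fin m → B)
    (hx : g.map (φ : A →+* B) = ∏ i, (Polynomial.X - Polynomial.C (x i))) :
    ∃ S : Subalgebra K B, φ.range ≤ S ∧ (∀ i, x i ∈ S) ∧ Module.Finite K S ∧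
      Module.finrank K S ≤ m.factorial * Module.finrank K A := by
  induction m generalizing A with
  | zero =>
    refine ⟨φ.range, le_rfl, fun i => i.elim0,
      Module.Finite.of_surjective φ.rangeRestrict.toLinearMap φ.rangeRestrict_surjective, ?_⟩
    rw [Nat.factorial_zero, one_mul]
    exact LinearMap.finrank_le_finrank_of_surjective (f := φ.rangeRestrict.toLinearMap)
      φ.rangeRestrict_surjective
  | succ m ih =>
    have : Nontrivial A := by
      by_contra h
      have := not_nontrivial_iff_subsingleton.mp h
      simp [Subsingleton.elim g 0] at hdeg
    have hroot : g.eval₂ (φ : A →+* B) (x 0) = 0 := by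
      rw [← Polynomial.eval_map, hx, Polynomial.eval_prod]
      exact Finset.prod_eq_zero (Finset.mem_univ 0) (by simp)
    have := hg.finite_adjoinRoot
    have := hg.free_adjoinRoot
    have : Module.Finite K (AdjoinRoot g) := Module.Finite.trans A _
    have hrank : Module.finrank K (AdjoinRoot g) = (m + 1) * Module.finrank K A := by
      rw [← Module.finrank_mul_finrank K A, (AdjoinRoot.powerBasis' hg).finrank,
        AdjoinRoot.powerBasis'_dim, hdeg, mul_comm]
    let ψ : AdjoinRoot g →ₐ[K] B := AdjoinRoot.liftAlgHom g φ (x 0) hroot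
    have hψ : (ψ : AdjoinRoot g →+* B).comp (AdjoinRoot.of g) = (φ : A →+* B) :=
      RingHom.ext fun a => by simp [ψ]
    have hψroot : ψ (AdjoinRoot.root g) = x 0 := by simp [ψ]
    set q := g.map (AdjoinRoot.of g) /ₘ (Polynomial.X - Polynomial.C (AdjoinRoot.root g)) with hq
    have hfac : (Polynomial.X - Polynomial.C (AdjoinRoot.root g)) * q = g.map (AdjoinRoot.of g) :=
      Polynomial.mul_divByMonic_eq_iff_isRoot.mpr (AdjoinRoot.isRoot_root g)
    have hqm : q.Monic := (Polynomial.monic_X_sub_C _).of_mul_monic_left (hfac ▸ hg.map _)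
    have : Nontrivial (AdjoinRoot g) := Module.nontrivial_of_finrank_pos (R := A) <| by
      rw [(AdjoinRoot.powerBasis' hg).finrank, AdjoinRoot.powerBasis'_dim, hdeg]
      exact m.succ_pos
    have hqdeg : q.natDegree = m := by
      rw [hq, Polynomial.natDegree_divByMonic _ (Polynomial.monic_X_sub_C _), hg.natDegree_map, hdeg, Polynomial.natDegree_X_sub_C,
        Nat.add_sub_cancel]
    have hqx : q.map (ψ : AdjoinRoot g →+* B) = ∏ i : Fin m, (Polynomial.X - Polynomial.C (x i.succ)) := by
      refine (Polynomial.monic_X_sub_C (x 0)).isRegular.left ?_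
      have := congrArg (Polynomial.map (ψ : AdjoinRoot g →+* B)) hfac
      rw [Polynomial.map_mul, Polynomial.map_map, hψ, hx, Fin.prod_univ_succ] at this
      simpa [hψroot] using this
    obtain ⟨S, hS, hxS, hfin, hle⟩ := ih ψ q hqm hqdeg (fun i => x i.succ) hqx
    refine ⟨S, ?_, Fin.cases (hS ⟨_, hψroot⟩) hxS, hfin, ?_⟩
    · rintro _ ⟨a, rfl⟩
      exact hS ⟨AdjoinRoot.of g a, RingHom.congr_fun hψ a⟩
    · rwa [hrank, ← mul_assoc, mul_comm _ (m + 1), ← Nat.factorial_succ] at hle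

/-- The ideal generated by the power sums `p_1, …, p_n`. -/
noncomputable def powerSumIdeal (K : Type*) [CommRing K] (n : ℕ) : Ideal (MvPolynomial (Fin n) K) :=
  Ideal.span (Set.range fun s : Fin n => ∑ i : Fin n, (X i) ^ ((s : ℕ) + 1))

variable {K : Type*} [Field K] {n : ℕ}

theorem psum_mem_powerSumIdeal {k : ℕ} (hk : 0 < k) (hkn : k ≤ n) :
    psum (Fin n) K k ∈ powerSumIdeal K n :=
  Ideal.subset_span ⟨⟨k - 1, by lia⟩, by simp [psum, Nat.sub_add_cancel hk]⟩

theorem esymm_mem_powerSumIdeal [CharZero K] {k : ℕ} (hk : 0 < k) (hkn : k ≤ n) :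
    esymm (Fin n) K k ∈ powerSumIdeal K n := by
  have h : (k : MvPolynomial (Fin n) K) * esymm (Fin n) K k ∈ powerSumIdeal K n := by
    rw [mul_esymm_eq_sum]
    refine Ideal.mul_mem_left _ _ (Ideal.sum_mem _ fun a ha => Ideal.mul_mem_left _ _ ?_)
    rw [Finset.mem_filter, Finset.HasAntidiagonal.mem_antidiagonal] at ha
    exact psum_mem_powerSumIdeal (by lia) (by lia)
  have hk0 : (k : K) ≠ 0 := Nat.cast_ne_zero.mpr hk.ne'
  have := Ideal.mul_mem_left _ (C (k : K)⁻¹) h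
  rwa [← mul_assoc, ← map_natCast (C : K →+* MvPolynomial (Fin n) K), ← map_mul,
    inv_mul_cancel₀ hk0, map_one, one_mul] at this

theorem prod_X_sub_C_mk_powerSumIdeal [CharZero K] :
    ∏ i : Fin n, (Polynomial.X - Polynomial.C (Ideal.Quotient.mk (powerSumIdeal K n) (X i))) =
      Polynomial.X ^ n := by
  have h := Multiset.prod_X_sub_X_eq_sum_esymm (Finset.univ.val.map
    fun i : Fin n => Ideal.Quotient.mk (powerSumIdeal K n) (X i))
  have hesymm (j : ℕ) : (Finset.univ.val.map
      fun i : Fin n => Ideal.Quotient.mk (powerSumIdeal K n) (X i)).esymm j =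
      Ideal.Quotient.mk (powerSumIdeal K n) (esymm (Fin n) K j) := by
    have := aeval_esymm_eq_multiset_esymm (Fin n) K j
      fun i => Ideal.Quotient.mk (powerSumIdeal K n) (X i)
    rw [← this, ← Ideal.Quotient.mkₐ_eq_mk K, ← comp_aeval_apply, aeval_X_left_apply]
  simp only [hesymm, Multiset.map_map, Multiset.card_map] at h
  refine h.trans ?_
  rw [Finset.sum_eq_single 0]
  · simp
  · intro j hj hj0
    have hjn : j ≤ n := by simpa [Nat.lt_succ_iff] using hj
    rw [Ideal.Quotient.eq_zero_iff_mem.mpr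
      (esymm_mem_powerSumIdeal (Nat.pos_of_ne_zero hj0) hjn)]
    simp
  · simp

theorem finrank_quotient_powerSumIdeal_le [CharZero K] :
    Module.Finite K (MvPolynomial (Fin n) K ⧸ powerSumIdeal K n) ∧
      Module.finrank K (MvPolynomial (Fin n) K ⧸ powerSumIdeal K n) ≤ n.factorial := by
  obtain ⟨S, -, hxS, hfin, hle⟩ := exists_subalgebra_finrank_le n
    (Algebra.ofId K (MvPolynomial (Fin n) K ⧸ powerSumIdeal K n)) (Polynomial.X ^ n)
    (Polynomial.monic_X_pow n) (Polynomial.natDegree_X_pow n) _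
    (by rw [prod_X_sub_C_mk_powerSumIdeal]; simp)
  have htop : S = ⊤ := by
    refine eq_top_iff.mpr fun b _ => ?_
    obtain ⟨f, rfl⟩ := Ideal.Quotient.mk_surjective b
    induction f using MvPolynomial.induction_on with
    | C a => exact S.algebraMap_mem a
    | add p q hp hq => exact S.add_mem (hp trivial) (hq trivial)
    | mul_X p i hp => exact S.mul_mem (hp trivial) (hxS i)
  subst htop
  rw [Module.finrank_self, mul_one] at hle
  exact ⟨Module.Finite.equiv Subalgebra.topEquiv.toLinearEquiv,
    (Subalgebra.topEquiv.toLinearEquiv.finrank_eq).symm.trans_le hle⟩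

end CoinvariantAlgebra

section VandermondePolynomial

/-- The Vandermonde polynomial `∏_{i < j} (X i - X j)`. -/
noncomputable def vandermondePoly (K : Type*) [CommRing K] (n : ℕ) : MvPolynomial (Fin n) K :=
  ∏ i : Fin n, ∏ j ∈ Finset.Ioi i, (X i - X j)

theorem vandermondePoly_eq_det (K : Type*) [CommRing K] (n : ℕ) :
    vandermondePoly K n = (Matrix.vandermonde fun i : Fin n => -X i).det := by
  rw [Matrix.det_vandermonde]
  exact Finset.prod_congr rfl fun i _ => Finset.prod_congr rfl fun j _ => by ring

theorem rename_swap_vandermondePoly (K : Type*) [CommRing K] {n : ℕ} {i j : Fin n} (hij : i ≠ j) :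
    rename (Equiv.swap i j) (vandermondePoly K n) = -vandermondePoly K n := by
  have h : (rename (Equiv.swap i j) : MvPolynomial (Fin n) K →ₐ[K] _).mapMatrix
      (Matrix.vandermonde fun i : Fin n => -X i) =
      (Matrix.vandermonde fun i : Fin n => -X i).submatrix (Equiv.swap i j) id := by
    ext1 a b
    simp [Matrix.vandermonde_apply]
  rw [vandermondePoly_eq_det, AlgHom.map_det, h, Matrix.det_permute, Equiv.Perm.sign_swap hij]
  simp

theorem coeff_mapDomain_swap_vandermondePoly (K : Type*) [CommRing K] {n : ℕ} {i j : Fin n}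
    (hij : i ≠ j) (γ : Fin n →₀ ℕ) :
    coeff (γ.mapDomain (Equiv.swap i j)) (vandermondePoly K n) =
      -coeff γ (vandermondePoly K n) := by
  have h := coeff_rename_mapDomain _ (Equiv.swap i j).injective (vandermondePoly K n) γ
  rw [rename_swap_vandermondePoly K hij, coeff_neg] at h
  rw [← h, neg_neg]

theorem totalDegree_vandermondePoly_le (K : Type*) [CommRing K] [Nontrivial K] (n : ℕ) :
    (vandermondePoly K n).totalDegree ≤ ∑ i ∈ Finset.range n, i := by
  have h (i : Fin n) : (∏ j ∈ Finset.Ioi i, (X i - X j : MvPolynomial (Fin n) K)).totalDegree ≤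
      n - 1 - i := by
    refine (totalDegree_finsetProd _ _).trans ?_
    rw [← Fin.card_Ioi, Finset.card_eq_sum_ones]
    refine Finset.sum_le_sum fun j _ => ?_
    exact (totalDegree_sub _ _).trans (by simp)
  refine (totalDegree_finsetProd _ _).trans ((Finset.sum_le_sum fun i _ => h i).trans_eq ?_)
  rw [Fin.sum_univ_eq_sum_range (fun i => n - 1 - i) n, Finset.sum_range_reflect (fun i => i)]

theorem sum_range_le_sum_of_injective {n : ℕ} {β : Fin n → ℕ} (hβ : Function.Injective β) :
    ∑ i ∈ Finset.range n, i ≤ ∑ i, β i := by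
  have hinj : Function.Injective fun i => (β i : ℤ) := Nat.cast_injective.comp hβ
  have h := Finset.sum_range_le_sum (s := Finset.univ.image fun i => (β i : ℤ)) (c := 0) (by simp)
  rw [Finset.card_image_of_injective _ hinj, Finset.sum_image hinj.injOn, Finset.card_univ,
    Fintype.card_fin] at h
  zify
  simpa using h

theorem degree_lex_X_sub_X (K : Type*) [Field K] {n : ℕ} {i j : Fin n} (hij : i < j) :
    MonomialOrder.lex.degree (X i - X j : MvPolynomial (Fin n) K) = Finsupp.single i 1 := by
  classical
  rw [sub_eq_add_neg, MonomialOrder.degree_add_of_lt, MonomialOrder.degree_X]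
  rw [MonomialOrder.degree_neg, MonomialOrder.degree_X, MonomialOrder.degree_X]
  rw [MonomialOrder.lex_lt_iff]
  exact Finsupp.Lex.single_lt_iff.mpr hij

theorem vandermondePoly_ne_zero (K : Type*) [Field K] (n : ℕ) : vandermondePoly K n ≠ 0 :=
  Finset.prod_ne_zero_iff.mpr fun _ _ => Finset.prod_ne_zero_iff.mpr fun _ hj =>
    sub_ne_zero.mpr fun h => (Finset.mem_Ioi.mp hj).ne (X_injective h)

theorem degree_lex_vandermondePoly (K : Type*) [Field K] {n : ℕ} (i : Fin n) :
    MonomialOrder.lex.degree (vandermondePoly K n) i = n - 1 - i := by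
  have h (i : Fin n) : MonomialOrder.lex.degree
      (∏ j ∈ Finset.Ioi i, (X i - X j : MvPolynomial (Fin n) K)) =
      Finsupp.single i (n - 1 - i : ℕ) := by
    rw [MonomialOrder.degree_prod fun j hj =>
        sub_ne_zero.mpr fun h => (Finset.mem_Ioi.mp hj).ne (X_injective h),
      Finset.sum_congr rfl fun j hj => degree_lex_X_sub_X K (Finset.mem_Ioi.mp hj)]
    simp
  rw [vandermondePoly, MonomialOrder.degree_prod fun i _ => Finset.prod_ne_zero_iff.mpr fun j hj =>
    sub_ne_zero.mpr fun h => (Finset.mem_Ioi.mp hj).ne (X_injective h)]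
  simp only [h, Finsupp.finsetSum_apply]
  rw [Finset.sum_eq_single i (fun j _ hj => Finsupp.single_eq_of_ne' hj) (by simp),
    Finsupp.single_eq_same]

end VandermondePolynomial

section VandermondeDerivatives

variable {K : Type} {n : ℕ}

theorem coeff_PDopHom_X_pow [CommSemiring K] (i : Fin n) (s : ℕ) (β : Fin n →₀ ℕ)
    (q : MvPolynomial (Fin n) K) :
    coeff β (PDopHom (X i ^ s) q) =
      ((β i + 1).ascFactorial s : K) * coeff (β + Finsupp.single i s) q := by
  rw [X_pow_eq_monomial, PDopHom_monomial, one_smul, coeff_ipdP,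
    Finset.prod_eq_single i (fun j _ hj => by simp [Finsupp.single_eq_of_ne hj]) (by simp)]
  simp

/-- Power sums of positive degree annihilate the Vandermonde polynomial, by antisymmetry. -/
theorem PDopHom_sum_X_pow_vandermondePoly [Field K] [CharZero K] {s : ℕ} (hs : 0 < s) :
    PDopHom (∑ i : Fin n, X i ^ s) (vandermondePoly K n) = 0 := by
  ext β
  rw [map_sum, LinearMap.sum_apply, coeff_sum, coeff_zero]
  simp only [coeff_PDopHom_X_pow]
  by_cases hβ : Function.Injective β
  · refine Finset.sum_eq_zero fun i _ => mul_eq_zero_of_right _ (coeff_eq_zero_of_totalDegree_lt ?_)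
    refine (totalDegree_vandermondePoly_le K n).trans_lt
      ((sum_range_le_sum_of_injective hβ).trans_lt ?_)
    change _ < (β + Finsupp.single i s).degree
    rw [map_add, Finsupp.degree_single, Finsupp.degree_eq_sum]
    lia
  · obtain ⟨a, b, hab, hne⟩ : ∃ a b, β a = β b ∧ a ≠ b := by
      simpa [Function.Injective] using hβ
    have hswap (i : Fin n) : β (Equiv.swap a b i) = β i := by
      rw [Equiv.swap_apply_def]
      split_ifs with h₁ h₂ <;> simp [*]
    have hmap : β.mapDomain (Equiv.swap a b) = β := by
      ext i
      rw [Finsupp.mapDomain_equiv_apply, Equiv.symm_swap, hswap]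
    refine self_eq_neg.mp ?_
    rw [← Finset.sum_neg_distrib]
    refine Fintype.sum_equiv (Equiv.swap a b) _ _ fun i => ?_
    rw [hswap, ← mul_neg, ← coeff_mapDomain_swap_vandermondePoly K hne, Finsupp.mapDomain_add,
      hmap, Finsupp.mapDomain_single, Equiv.swap_apply_self]

/-- The derivatives `∂^α q` with `α` dividing the leading exponent of `q` have distinct leading
exponents, hence are linearly independent. -/
theorem linearIndependent_ipdP [Field K] [CharZero K] (m : MonomialOrder (Fin n))
    {q : MvPolynomial (Fin n) K} (hq : q ≠ 0) :
    LinearIndependent K fun α : Set.Iic (m.degree q) => ipdP (α : Fin n →₀ ℕ) q := by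
  classical
  rw [linearIndependent_iff']
  intro s c hsum
  by_contra! hc
  obtain ⟨α, hα, hmin⟩ := (s.filter (c · ≠ 0)).exists_min_image (fun α => m.toSyn α.1)
    (by simpa [Finset.Nonempty] using hc)
  rw [Finset.mem_filter] at hα
  have h := congrArg (coeff (m.degree q - α.1)) hsum
  rw [coeff_sum, Finset.sum_eq_single α _ (fun h => absurd hα.1 h), coeff_smul, coeff_ipdP,
    tsub_add_cancel_of_le α.2, coeff_zero, smul_eq_zero, mul_eq_zero] at h
  · refine h.elim hα.2 (Or.rec (fun h => ?_) (m.coeff_degree_ne_zero_iff.mpr hq))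
    obtain ⟨i, -, hi⟩ := Finset.prod_eq_zero_iff.mp h
    exact (Nat.ascFactorial_pos _ _).ne' (Nat.cast_eq_zero.mp hi)
  · intro α' hα' hne
    by_cases hc' : c α' = 0
    · rw [hc', zero_smul, coeff_zero]
    rw [coeff_smul, coeff_ipdP, m.coeff_eq_zero_of_lt, mul_zero, smul_zero]
    have hlt : m.toSyn α.1 < m.toSyn α'.1 :=
      (hmin α' (Finset.mem_filter.mpr ⟨hα', hc'⟩)).lt_of_ne fun h =>
        hne (Subtype.ext (m.toSyn.injective h.symm))
    have := add_lt_add_right hlt (m.toSyn (m.degree q - α.1))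
    rwa [← map_add, ← map_add, tsub_add_cancel_of_le α.2] at this

/-- The span of all iterated partial derivatives of `q`. -/
noncomputable def derivativeSpan [CommSemiring K] (q : MvPolynomial (Fin n) K) :
    Submodule K (MvPolynomial (Fin n) K) :=
  Submodule.span K {p | ∃ α : Fin n → ℕ, p = ipdP α q}

theorem derivativeSpan_vandermondePoly_le [Field K] [CharZero K] :
    derivativeSpan (vandermondePoly K n) ≤ polySolutions (powerSumIdeal K n) := by
  refine Submodule.span_le.mpr ?_
  rintro _ ⟨α, rfl⟩
  have h := PDopHom_monomial (Finsupp.equivFunOnFinite.symm α) 1 (vandermondePoly K n)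
  rw [one_smul, Finsupp.coe_equivFunOnFinite_symm] at h
  rw [← h]
  refine PDopHom_mem_polySolutions (mem_polySolutions_span.mpr ?_) _
  rintro _ ⟨s, rfl⟩
  exact PDopHom_sum_X_pow_vandermondePoly s.succ_pos

theorem factorial_le_finrank_derivativeSpan [Field K] [CharZero K]
    [Module.Finite K (derivativeSpan (vandermondePoly K n))] :
    n.factorial ≤ Module.finrank K (derivativeSpan (vandermondePoly K n)) := by
  classical
  set ρ := MonomialOrder.lex.degree (vandermondePoly K n) with hρ
  have hli := linearIndependent_ipdP MonomialOrder.lex (vandermondePoly_ne_zero K n)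
  have hli' : LinearIndependent K fun α : Set.Iic ρ =>
      (⟨ipdP α.1 (vandermondePoly K n), Submodule.subset_span ⟨α.1, rfl⟩⟩ :
        derivativeSpan (vandermondePoly K n)) :=
    LinearIndependent.of_comp (Submodule.subtype _) hli
  have hcard : Fintype.card (Set.Iic ρ) = n.factorial := by
    rw [← Set.toFinset_card, Set.toFinset_Iic, Finsupp.card_Iic,
      Finset.prod_subset (Finset.subset_univ _) fun i _ hi => by
        rw [Finsupp.notMem_support_iff.mp hi, Nat.card_Iic, zero_add]]
    simp only [Nat.card_Iic, hρ, degree_lex_vandermondePoly]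
    rw [Fin.prod_univ_eq_prod_range (fun i => n - 1 - i + 1) n,
      Finset.prod_range_reflect (fun i => i + 1), Finset.prod_range_add_one_eq_factorial]
  exact hcard.symm.trans_le hli'.fintype_card_le_finrank

/-- The solution space of the power sum ideal has dimension `n!` and is spanned by the derivatives
of the Vandermonde polynomial. -/
theorem polySolutions_powerSumIdeal [Field K] [CharZero K] :
    polySolutions (powerSumIdeal K n) = derivativeSpan (vandermondePoly K n) ∧
      Module.Finite K (derivativeSpan (vandermondePoly K n)) ∧
      Module.finrank K (derivativeSpan (vandermondePoly K n)) = n.factorial := by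
  obtain ⟨_, hle⟩ := finrank_quotient_powerSumIdeal_le (K := K) (n := n)
  have := finite_polySolutions (powerSumIdeal K n)
  have hsub := derivativeSpan_vandermondePoly_le (K := K) (n := n)
  have : Module.Finite K (derivativeSpan (vandermondePoly K n)) :=
    Submodule.finiteDimensional_of_le hsub
  have hupper := (finrank_polySolutions_le (powerSumIdeal K n)).trans hle
  have hlower := factorial_le_finrank_derivativeSpan (K := K) (n := n)
  have heq := Submodule.eq_of_le_of_finrank_le hsub (hupper.trans hlower)
  exact ⟨heq.symm, this, (heq ▸ hupper).antisymm hlower⟩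

end VandermondeDerivatives

/-- for the ideal `I` generated by the power sums `p_s = x₁^s + ⋯ + xₙ^s`,
`s = 1,…,n`, the space of polynomial solutions is an `n!`-dimensional `ℂ`-vector space,
equal to the span of the Vandermonde polynomial `Δ = ∏_{i<j}(z_i − z_j)` together with
all of its iterated partial derivatives. -/
theorem stmt15 {n : ℕ} (hn : 1 ≤ n)
    (I : Ideal (MvPolynomial (Fin n) ℂ))
    (hI : I = Ideal.span (Set.range fun s : Fin n =>
      ∑ i : Fin n, (X i : MvPolynomial (Fin n) ℂ) ^ ((s : ℕ) + 1)))
    (Δ : MvPolynomial (Fin n) ℂ)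
    (hΔ : Δ = ∏ i : Fin n, ∏ j ∈ Finset.Ioi i, (X i - X j)) :
    {q : MvPolynomial (Fin n) ℂ | ∀ f ∈ I, PDopP f q = 0}
      = (Submodule.span ℂ {p : MvPolynomial (Fin n) ℂ | ∃ α : Fin n → ℕ, p = ipdP α Δ} :
          Submodule ℂ (MvPolynomial (Fin n) ℂ)) ∧
    FiniteDimensional ℂ
      (Submodule.span ℂ {p : MvPolynomial (Fin n) ℂ | ∃ α : Fin n → ℕ, p = ipdP α Δ}) ∧
    Module.finrank ℂ
      (Submodule.span ℂ {p : MvPolynomial (Fin n) ℂ | ∃ α : Fin n → ℕ, p = ipdP α Δ})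
      = Nat.factorial n := by
  subst hI hΔ
  obtain ⟨heq, hfin, hrank⟩ := polySolutions_powerSumIdeal (K := ℂ) (n := n)
  refine ⟨?_, hfin, hrank⟩
  refine Eq.trans (Set.ext fun q => ?_) (congrArg SetLike.coe heq)
  simp only [Set.mem_ofPred_eq, SetLike.mem_coe, mem_polySolutions, PDopHom_apply]
  rfl
end
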